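/- arXiv:1002.2786 — 3 statements merged into one kernel-verified Lean document; each statement's English description precedes it below -/
import Mathlib

section
/- There is a total computable function F : ℕ × ℕ → ℕ such that for all m, n ∈ ℕ, F(m, n) is the code of a finite presentation Π_{m,n} whose presented group G_{m,n} is perfect (its commutator subgroup is the whole group) and torsion-free (every element g ≠ 1 has infinite order, i.e. orderOf g = 0), and such that G_{m,n} is trivial if and only if n ∈ W_m. -/
/-- A word in `m` generators. -/
abbrev Word (m : ℕ) : Type := List (Fin m × Bool)

/-- A finite presentation: a number of generators together with a finite list of relator words. -/
abbrev FinPres : Type := Σ m : ℕ, List (Word m)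

/-- The set of relators of a finite presentation, as elements of the free group. -/
def FinPres.rels (P : FinPres) : Set (FreeGroup (Fin P.1)) :=
  {x | ∃ r ∈ P.2, x = FreeGroup.mk r}

/-- The group presented by a finite presentation. -/
abbrev FinPres.Grp (P : FinPres) : Type := PresentedGroup P.rels

/-- The projection from the free group onto the presented group. -/
def FinPres.proj (P : FinPres) : FreeGroup (Fin P.1) →* P.Grp :=
  PresentedGroup.mk P.rels

/-- The `n`-th recursively enumerable set: the domain of the `n`-th partial recursive
function under the canonical numbering. -/
def W (n : ℕ) : Set ℕ := {x | ((Denumerable.ofNat Nat.Partrec.Code n).eval x).Dom}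

/-- The set of orders of nontrivial torsion elements of a group. -/
def TorOrd (G : Type*) [Group G] : Set ℕ := {n | 2 ≤ n ∧ ∃ g : G, orderOf g = n}

section LetterWords

variable {H P : Type*} [Group H] [Group P]

/-- The product in `P` of a list of syllables `τ ^ u * p h`. -/
def letterProd (p : H →* P) (τ : P) (l : List (ℤˣ × H)) : P :=
  (l.map fun a => τ ^ (a.1 : ℤ) * p a.2).prod

/-- Two consecutive syllables do not form a pinch with respect to `D`. -/
def NoPinch (D : ℤˣ → Set H) (a b : ℤˣ × H) : Prop := a.2 ∈ D a.1 → a.1 = b.1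

variable (p : H →* P) (τ : P)

@[simp]
theorem letterProd_nil : letterProd p τ [] = 1 := rfl

@[simp]
theorem letterProd_cons (a : ℤˣ × H) (l : List (ℤˣ × H)) :
    letterProd p τ (a :: l) = τ ^ (a.1 : ℤ) * p a.2 * letterProd p τ l := by
  simp [letterProd]

@[simp]
theorem letterProd_append (l l' : List (ℤˣ × H)) :
    letterProd p τ (l ++ l') = letterProd p τ l * letterProd p τ l' := by
  simp [letterProd]

theorem letterProd_flatten_replicate (k : ℕ) (l : List (ℤˣ × H)) :
    letterProd p τ (List.replicate k l).flatten = letterProd p τ l ^ k := by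
  induction k with
  | zero => simp
  | succ k ih => simp [List.replicate_succ, ih, pow_succ']

theorem exists_letterProd_merge (l l' : List (ℤˣ × H)) (h₀ h : H) :
    ∃ h₁ l₁, l₁.length = l.length + l'.length ∧
      p h₀ * letterProd p τ l * p h * letterProd p τ l' = p h₁ * letterProd p τ l₁ := by
  induction l generalizing h₀ with
  | nil => exact ⟨h₀ * h, l', by simp, by simp⟩
  | cons a l ih =>
    obtain ⟨h₁, l₁, hl, e⟩ := ih a.2
    refine ⟨h₀, (a.1, h₁) :: l₁, by simp [hl]; omega, ?_⟩
    simp only [letterProd_cons, mul_assoc] at e ⊢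
    rw [← e]

omit [Group H] in
theorem exists_pinch_of_not_isChain {D : ℤˣ → Set H} {l : List (ℤˣ × H)}
    (hl : ¬ l.IsChain (NoPinch D)) :
    ∃ l₁ a b l₂, l = l₁ ++ a :: b :: l₂ ∧ ¬ NoPinch D a b := by
  induction l with
  | nil => simp at hl
  | cons a l ih =>
    cases l with
    | nil => simp at hl
    | cons b l =>
      by_cases hab : NoPinch D a b
      · rw [List.isChain_cons_cons] at hl
        obtain ⟨l₁, c, d, l₂, e, hcd⟩ := ih fun h => hl ⟨hab, h⟩
        exact ⟨a :: l₁, c, d, l₂, by simp [e], hcd⟩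
      · exact ⟨[], a, b, l, rfl, hab⟩

variable {D : ℤˣ → Set H}
  (hD : ∀ u, ∀ h ∈ D u, ∃ h', τ ^ (u : ℤ) * p h * τ ^ (-(u : ℤ)) = p h')

include hD in
theorem exists_pinch_eq {a b : ℤˣ × H} (hab : ¬ NoPinch D a b) :
    ∃ h, τ ^ (a.1 : ℤ) * p a.2 * (τ ^ (b.1 : ℤ) * p b.2) = p h := by
  simp only [NoPinch, Classical.not_imp] at hab
  obtain ⟨h, e⟩ := hD _ _ hab.1
  have : b.1 = -a.1 := by
    rcases Int.units_eq_one_or a.1 with h1 | h1 <;> rcases Int.units_eq_one_or b.1 with h2 | h2 <;>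
      simp_all
  refine ⟨h * b.2, ?_⟩
  rw [this, ← mul_assoc, Units.val_neg, e, map_mul]

include hD in
theorem exists_shorter {l : List (ℤˣ × H)} (hl : ¬ l.IsChain (NoPinch D)) (h : H) :
    ∃ h' l', l'.length < l.length ∧ p h * letterProd p τ l = p h' * letterProd p τ l' := by
  obtain ⟨l₁, a, b, l₂, rfl, hab⟩ := exists_pinch_of_not_isChain hl
  obtain ⟨g, e⟩ := exists_pinch_eq p τ hD hab
  obtain ⟨h', l', hl', e'⟩ := exists_letterProd_merge p τ l₁ l₂ h g
  refine ⟨h', l', by simp [hl'], ?_⟩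
  rw [← e', ← e]
  simp only [letterProd_append, letterProd_cons]
  group

include hD in
theorem exists_isChain_letterProd (h : H) (l : List (ℤˣ × H)) :
    ∃ h' l', l'.IsChain (NoPinch D) ∧ p h * letterProd p τ l = p h' * letterProd p τ l' := by
  induction hn : l.length using Nat.strong_induction_on generalizing h l with
  | _ n ih =>
    by_cases hl : l.IsChain (NoPinch D)
    · exact ⟨h, l, hl, rfl⟩
    · obtain ⟨h₁, l₁, hlt, e⟩ := exists_shorter p τ hD hl h
      obtain ⟨h₂, l₂, hc, e₂⟩ := ih _ (hn ▸ hlt) h₁ l₁ rfl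
      exact ⟨h₂, l₂, hc, e.trans e₂⟩

theorem exists_letterProd_of_mem_closure {x : P}
    (hx : x ∈ Subgroup.closure (Set.range p ∪ {τ})) :
    ∃ h l, x = p h * letterProd p τ l := by
  induction hx using Subgroup.closure_induction_left with
  | one => exact ⟨1, [], by simp⟩
  | mul_left x hx y _ ih =>
    obtain ⟨h, l, rfl⟩ := ih
    rcases hx with ⟨g, rfl⟩ | rfl
    · exact ⟨g * h, l, by simp [mul_assoc]⟩
    · exact ⟨1, (1, h) :: l, by simp [mul_assoc]⟩
  | inv_mul_cancel x hx y _ ih =>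
    obtain ⟨h, l, rfl⟩ := ih
    rcases hx with ⟨g, rfl⟩ | rfl
    · exact ⟨g⁻¹ * h, l, by simp [mul_assoc]⟩
    · exact ⟨1, (-1, h) :: l, by simp [mul_assoc]⟩

end LetterWords

/-- Every element of finite order is trivial. -/
def TorsionFree (G : Type*) [Group G] : Prop := ∀ g : G, ∀ n, 0 < n → g ^ n = 1 → g = 1

theorem TorsionFree.of_injective {G H : Type*} [Group G] [Group H] (hH : TorsionFree H)
    (f : G →* H) (hf : Function.Injective f) : TorsionFree G := fun g n hn e =>
  hf <| by rw [map_one]; exact hH _ n hn (by rw [← map_pow, e, map_one])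

theorem TorsionFree.prod {G H : Type*} [Group G] [Group H] (hG : TorsionFree G)
    (hH : TorsionFree H) : TorsionFree (G × H) := fun _ n hn e =>
  Prod.ext (hG _ n hn (congrArg Prod.fst e)) (hH _ n hn (congrArg Prod.snd e))

theorem TorsionFree.zpow_eq_one {G : Type*} [Group G] (hG : TorsionFree G) {g : G} (hg : g ≠ 1)
    {n : ℤ} (h : g ^ n = 1) : n = 0 := by
  by_contra hn
  refine hg (hG g n.natAbs (Int.natAbs_pos.2 hn) ?_)
  rcases Int.natAbs_eq n with e | e <;> rw [e] at h <;> simpa using h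

theorem TorsionFree.orderOf_eq_zero {G : Type*} [Group G] (hG : TorsionFree G) {g : G}
    (hg : g ≠ 1) : orderOf g = 0 :=
  orderOf_eq_zero_iff'.2 fun n hn h => hg (hG g n hn h)

section HNN

variable {K C : Type} [Group K] [Group C] (α β : C →* K)
  (hα : Function.Injective α) (hβ : Function.Injective β)

/-- The HNN extension of `K` whose stable letter conjugates `α c` to `β c`. -/
abbrev HNN : Type := HNNExtension K α.range β.range
  ((MonoidHom.ofInjective hα).symm.trans (MonoidHom.ofInjective hβ))

/-- The associated subgroups of an HNN extension, indexed by a sign. -/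
def hnnSide (u : ℤˣ) : Set K := if u = 1 then Set.range α else Set.range β

namespace HNN

/-- The inclusion of the base group. -/
noncomputable abbrev of : K →* HNN α β hα hβ := HNNExtension.of

/-- The stable letter. -/
noncomputable abbrev t : HNN α β hα hβ := HNNExtension.t

theorem t_mul (c : C) : t α β hα hβ * of α β hα hβ (α c) = of α β hα hβ (β c) * t α β hα hβ := by
  have := HNNExtension.t_mul_of (φ := (MonoidHom.ofInjective hα).symm.trans
    (MonoidHom.ofInjective hβ)) (MonoidHom.ofInjective hα c)
  rw [MulEquiv.trans_apply, MulEquiv.symm_apply_apply] at this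
  exact this

theorem exists_lift {M : Type} [Group M] (f : K →* M) (x : M)
    (h : ∀ c, x * f (α c) = f (β c) * x) :
    ∃ F : HNN α β hα hβ →* M, (∀ k, F (of α β hα hβ k) = f k) ∧ F (t α β hα hβ) = x := by
  refine ⟨HNNExtension.lift f x ?_, fun k => HNNExtension.lift_of _ _ _ _,
    HNNExtension.lift_t _ _ _⟩
  rintro ⟨_, c, rfl⟩
  have e : (MonoidHom.ofInjective hα).symm ⟨α c, c, rfl⟩ = c := by
    rw [MulEquiv.symm_apply_eq]; rfl
  rw [MulEquiv.trans_apply, e]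
  exact h c

theorem of_injective : Function.Injective (of α β hα hβ) := HNNExtension.of_injective _

theorem eq_nil_of_isChain {l : List (ℤˣ × K)} (hl : l.IsChain (NoPinch (hnnSide α β)))
    {g k : K} (h : of α β hα hβ g * letterProd (of α β hα hβ) (t α β hα hβ) l
      = of α β hα hβ k) : l = [] := by
  refine HNNExtension.ReducedWord.toList_eq_nil_of_mem_of_range
    ((MonoidHom.ofInjective hα).symm.trans (MonoidHom.ofInjective hβ)) ⟨g, l, ?_⟩ ⟨k, h.symm⟩
  refine hl.imp fun a b hab hm => hab ?_
  rw [HNNExtension.toSubgroup] at hm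
  rw [hnnSide]
  split_ifs with h1
  · simpa [h1] using hm
  · simpa [h1] using hm

theorem pinch (u : ℤˣ) (g : K) (hg : g ∈ hnnSide α β u) :
    ∃ g', t α β hα hβ ^ (u : ℤ) * of α β hα hβ g * t α β hα hβ ^ (-(u : ℤ)) = of α β hα hβ g' := by
  rcases Int.units_eq_one_or u with rfl | rfl
  · obtain ⟨c, rfl⟩ : g ∈ Set.range α := by simpa [hnnSide] using hg
    exact ⟨β c, by simp [t_mul]⟩
  · obtain ⟨c, rfl⟩ : g ∈ Set.range β := by simpa [hnnSide] using hg
    exact ⟨α c, by simp [mul_assoc, ← t_mul]⟩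

theorem closure_eq_top :
    Subgroup.closure (Set.range (of α β hα hβ) ∪ {t α β hα hβ}) = ⊤ := by
  rw [eq_top_iff]
  rintro x -
  induction x using HNNExtension.induction_on with
  | of g => exact Subgroup.subset_closure (Or.inl ⟨g, rfl⟩)
  | t => exact Subgroup.subset_closure (Or.inr rfl)
  | mul x y hx hy => exact mul_mem hx hy
  | inv x hx => exact inv_mem hx

theorem torsionFree (hK : TorsionFree K) : TorsionFree (HNN α β hα hβ) := by
  intro x n hn hx
  set p := of α β hα hβ
  set τ := t α β hα hβ
  have key : ∀ m : ℕ, ∀ h (l : List (ℤˣ × K)), l.length = m →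
      (p h * letterProd p τ l) ^ n = 1 → p h * letterProd p τ l = 1 := by
    intro m
    induction m using Nat.strong_induction_on with
    | _ m ih =>
      intro h l hl hpow
      by_cases hc : l.IsChain (NoPinch (hnnSide α β))
      swap
      · obtain ⟨h', l', hlt, e⟩ := exists_shorter p τ (pinch α β hα hβ) hc h
        rw [e]; rw [e] at hpow
        exact ih _ (hl ▸ hlt) h' l' rfl hpow
      rcases List.eq_nil_or_concat l with rfl | ⟨l', c, rfl⟩
      · simp only [letterProd_nil, mul_one] at hpow ⊢
        rw [← map_pow] at hpow
        rw [hK h n hn (of_injective α β hα hβ (by rw [map_one]; exact hpow)), map_one]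
      set w := l' ++ [(c.1, c.2 * h)] with hw
      have hconj : letterProd p τ w = (p h)⁻¹ * (p h * letterProd p τ (l'.concat c)) * p h := by
        simp [hw, mul_assoc]
      have hw1 : letterProd p τ w ^ n = 1 := by
        have := conj_pow (i := n) (a := (p h)⁻¹) (b := p h * letterProd p τ (l'.concat c))
        rw [inv_inv, hpow] at this
        rw [hconj, this]; simp
      have back : letterProd p τ w = 1 → p h * letterProd p τ (l'.concat c) = 1 := by
        intro h1
        have : p h * letterProd p τ (l'.concat c) = p h * letterProd p τ w * (p h)⁻¹ := by
          rw [hconj]; group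
        rw [this, h1]; simp
      have hlen : w.length = m := by simp [hw, ← hl]
      have hshort : ∀ h' l'', l''.length < m → (p h' * letterProd p τ l'') ^ n = 1 →
          p h' * letterProd p τ l'' = 1 := fun h' l'' hlt => ih _ hlt h' l'' rfl
      apply back
      by_cases hcw : w.IsChain (NoPinch (hnnSide α β))
      swap
      · obtain ⟨h', l'', hlt, e⟩ := exists_shorter p τ (pinch α β hα hβ) hcw 1
        rw [map_one, one_mul] at e
        rw [e]; rw [e] at hw1
        exact hshort _ _ (hlen ▸ hlt) hw1
      by_cases hcyc : ∀ y ∈ w.head?, NoPinch (hnnSide α β) (c.1, c.2 * h) y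
      · exfalso
        have hne : w ≠ [] := by simp [hw]
        have hch : (List.replicate n w).flatten.IsChain (NoPinch (hnnSide α β)) := by
          rw [List.isChain_flatten (by simp [hne.symm])]
          refine ⟨fun l'' hl'' => (List.eq_of_mem_replicate hl'') ▸ hcw, ?_⟩
          refine List.isChain_replicate_of_rel _ ?_
          intro x hx y hy
          simp only [hw, List.getLast?_append, List.getLast?_singleton, Option.some_or,
            Option.mem_def, Option.some.injEq] at hx
          exact hx ▸ hcyc y hy
        have := eq_nil_of_isChain α β hα hβ hch (g := 1) (k := 1) (by
          rw [letterProd_flatten_replicate]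
          change _ * letterProd p τ w ^ n = _
          rw [hw1]; simp)
        rw [List.flatten_eq_nil_iff] at this
        exact hne (this w (by simp [hn.ne']))
      · simp only [not_forall] at hcyc
        obtain ⟨y, hy, hpin⟩ := hcyc
        obtain ⟨g, e⟩ := exists_pinch_eq p τ (pinch α β hα hβ) hpin
        cases l' with
        | nil =>
          simp only [hw, List.nil_append, List.head?_cons, Option.mem_def,
            Option.some.injEq] at hy
          exact (hpin fun _ => by rw [← hy]).elim
        | cons a l' =>
          simp only [hw, List.cons_append, List.head?_cons, Option.mem_def,
            Option.some.injEq] at hy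
          subst hy
          set z := τ ^ (c.1 : ℤ) * p (c.2 * h) with hz
          have e1 : z * letterProd p τ w * z⁻¹ = p g * letterProd p τ l' := by
            rw [← e]
            simp [hw, hz, mul_assoc]
          have e2 : p g * letterProd p τ l' = 1 := hshort g l'
            (by simp [← hlen, hw]) (by rw [← e1, conj_pow, hw1]; simp)
          rw [e2] at e1
          exact conj_eq_one_iff.1 e1
  obtain ⟨h, l, rfl⟩ := exists_letterProd_of_mem_closure p τ
    (show x ∈ _ by rw [closure_eq_top]; trivial)
  exact key _ h l rfl hx

end HNN

end HNN

section HNNSubgroups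

variable {K C : Type} [Group K] [Group C] (α β : C →* K)
  (hα : Function.Injective α) (hβ : Function.Injective β)

namespace HNN

theorem exists_eq_of_map_mem_range {H P : Type*} [Group H] [Group P] (p : H →* P) (τ : P)
    (Φ : P →* HNN α β hα hβ) (f : H →* K) (hp : ∀ h, Φ (p h) = of α β hα hβ (f h))
    (hτ : Φ τ = t α β hα hβ)
    (hD : ∀ u h, f h ∈ hnnSide α β u → ∃ h', τ ^ (u : ℤ) * p h * τ ^ (-(u : ℤ)) = p h')
    {x : P} (hx : x ∈ Subgroup.closure (Set.range p ∪ {τ})) {k : K}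
    (hr : Φ x = of α β hα hβ k) : ∃ h, x = p h := by
  obtain ⟨h, l, rfl⟩ := exists_letterProd_of_mem_closure p τ hx
  obtain ⟨h', l', hc, e⟩ := exists_isChain_letterProd p τ
    (D := fun u => f ⁻¹' hnnSide α β u) hD h l
  have hmap : ∀ l : List (ℤˣ × H), Φ (letterProd p τ l) =
      letterProd (of α β hα hβ) (t α β hα hβ) (l.map (Prod.map id f)) := by
    intro l
    induction l with
    | nil => simp
    | cons a l ih => simp [ih, hp, hτ]
  rw [e] at hr ⊢
  rw [map_mul, hp, hmap] at hr
  have hnil := eq_nil_of_isChain α β hα hβ ((List.isChain_map _).2 hc) hr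
  exact ⟨h', by simp [List.map_eq_nil_iff.1 hnil]⟩

theorem mem_of_of_mem_closure (H : Subgroup K) (hH : ∀ c, α c ∈ H ↔ β c ∈ H) {k : K}
    (hk : of α β hα hβ k ∈ Subgroup.closure (of α β hα hβ '' H ∪ {t α β hα hβ})) : k ∈ H := by
  suffices ∃ h, of α β hα hβ k = ((of α β hα hβ).comp H.subtype) h by
    obtain ⟨h, e⟩ := this
    rw [of_injective α β hα hβ e]
    exact h.2
  refine exists_eq_of_map_mem_range α β hα hβ ((of α β hα hβ).comp H.subtype)
    (t α β hα hβ) (MonoidHom.id _) H.subtype (fun _ => rfl) rfl ?_ (x := of α β hα hβ k)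
    (by simpa [Set.range_comp] using hk) rfl
  · intro u h hu
    rcases Int.units_eq_one_or u with rfl | rfl
    · obtain ⟨c, hc⟩ : H.subtype h ∈ Set.range α := by simpa [hnnSide] using hu
      refine ⟨⟨β c, (hH c).1 (hc ▸ h.2)⟩, ?_⟩
      simp only [MonoidHom.comp_apply, ← hc]
      simp [t_mul]
    · obtain ⟨c, hc⟩ : H.subtype h ∈ Set.range β := by simpa [hnnSide] using hu
      refine ⟨⟨α c, (hH c).2 (hc ▸ h.2)⟩, ?_⟩
      simp only [MonoidHom.comp_apply, ← hc]
      simp [mul_assoc, ← t_mul]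

theorem injective_freeGroup_lift {h : K} (hh : ∀ n : ℤ, h ^ n = 1 → n = 0)
    (hhα : ∀ c, α c ∈ Subgroup.zpowers h → c = 1) (hhβ : ∀ c, β c ∈ Subgroup.zpowers h → c = 1) :
    Function.Injective
      (FreeGroup.lift fun b : Bool => if b then t α β hα hβ else of α β hα hβ h) := by
  rw [injective_iff_map_eq_one]
  intro x hx
  set Φ := FreeGroup.lift fun b : Bool => if b then t α β hα hβ else of α β hα hβ h
  have hz : ∀ n : Multiplicative ℤ, h ^ n.toAdd = 1 → n = 1 := fun n e =>
    Multiplicative.toAdd.injective (hh _ e)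
  suffices ∃ n, x = zpowersHom (FreeGroup Bool) (FreeGroup.of false) n by
    obtain ⟨n, rfl⟩ := this
    have : Φ (zpowersHom (FreeGroup Bool) (FreeGroup.of false) n) = of α β hα hβ (h ^ n.toAdd) := by
      simp [Φ]
    rw [this, ← map_one (of α β hα hβ)] at hx
    rw [hz n (of_injective α β hα hβ hx), map_one]
  refine exists_eq_of_map_mem_range α β hα hβ
    (zpowersHom (FreeGroup Bool) (FreeGroup.of false)) (FreeGroup.of true) Φ (zpowersHom K h)
    (by simp [Φ]) (by simp [Φ]) ?_ (x := x) ?_ (k := 1) (by simpa using hx)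
  · intro u n hn
    refine ⟨1, ?_⟩
    suffices n = 1 by simp [this]
    apply hz
    have hmem : zpowersHom K h n ∈ Subgroup.zpowers h := ⟨n.toAdd, by simp⟩
    rw [← zpowersHom_apply]
    rw [hnnSide] at hn
    split_ifs at hn
    · obtain ⟨c, hc⟩ := hn
      rw [← hc] at hmem ⊢
      rw [hhα c hmem, map_one]
    · obtain ⟨c, hc⟩ := hn
      rw [← hc] at hmem ⊢
      rw [hhβ c hmem, map_one]
  · have : (⊤ : Subgroup (FreeGroup Bool)) ≤ Subgroup.closure (Set.range
        (zpowersHom (FreeGroup Bool) (FreeGroup.of false)) ∪ {FreeGroup.of true}) := by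
      rw [← FreeGroup.closure_range_of, Subgroup.closure_le]
      rintro _ ⟨b, rfl⟩
      apply Subgroup.subset_closure
      cases b
      · exact Or.inl ⟨Multiplicative.ofAdd 1, by simp⟩
      · exact Or.inr rfl
    exact this trivial

end HNN

end HNNSubgroups

/-- An HNN extension of `K` with a family of stable letters `r i` conjugating `α i c` to `β i c`,
given by its universal property together with the consequences of Britton's lemma. -/
structure MultiHNN {K C ι : Type} [Group K] [Group C] (α β : ι → C →* K) where
  /-- The underlying group. -/
  G : Type
  [group : Group G]
  /-- The inclusion of the base group. -/
  of : K →* G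
  /-- The stable letters. -/
  r : ι → G
  of_injective : Function.Injective of
  rel : ∀ i c, r i * of (α i c) = of (β i c) * r i
  exists_lift : ∀ {M : Type} [Group M] (f : K →* M) (s : ι → M),
    (∀ i c, s i * f (α i c) = f (β i c) * s i) →
    ∃ F : G →* M, (∀ k, F (of k) = f k) ∧ ∀ i, F (r i) = s i
  torsionFree : TorsionFree K → TorsionFree G
  mem_of_of_mem_closure : ∀ H : Subgroup K, (∀ i c, α i c ∈ H ↔ β i c ∈ H) →
    ∀ k, of k ∈ Subgroup.closure (of '' H ∪ Set.range r) → k ∈ H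
  closure_eq_top : Subgroup.closure (Set.range of ∪ Set.range r) = ⊤

attribute [instance] MultiHNN.group

namespace MultiHNN

variable {K C : Type} [Group K] [Group C]

/-- Reindexing the stable letters. -/
def reindex {ι κ : Type} (e : ι ≃ κ) {α β : κ → C →* K}
    (M : MultiHNN (fun i => α (e i)) fun i => β (e i)) : MultiHNN α β where
  G := M.G
  of := M.of
  r := M.r ∘ e.symm
  of_injective := M.of_injective
  rel i c := by simpa using M.rel (e.symm i) c
  exists_lift f s h := by
    obtain ⟨F, h1, h2⟩ := M.exists_lift f (s ∘ e) fun i => h (e i)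
    exact ⟨F, h1, fun i => by simp [h2]⟩
  torsionFree := M.torsionFree
  mem_of_of_mem_closure H hH k hk := M.mem_of_of_mem_closure H (fun i => hH (e i)) k
    (by rwa [e.symm.surjective.range_comp] at hk)
  closure_eq_top := by rw [e.symm.surjective.range_comp]; exact M.closure_eq_top

/-- No stable letters. -/
def empty (α β : PEmpty → C →* K) : MultiHNN α β where
  G := K
  of := MonoidHom.id K
  r := PEmpty.elim
  of_injective := Function.injective_id
  rel i := i.elim
  exists_lift f _ _ := ⟨f, fun _ => rfl, fun i => i.elim⟩
  torsionFree := id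
  mem_of_of_mem_closure H _ k hk := by simpa [Set.range_eq_empty] using hk
  closure_eq_top := by simp

/-- Adding one stable letter. -/
noncomputable def option {ι : Type} {α β : Option ι → C →* K}
    (M : MultiHNN (fun i => α (some i)) fun i => β (some i))
    (hα : Function.Injective (α none)) (hβ : Function.Injective (β none)) : MultiHNN α β where
  G := HNN (M.of.comp (α none)) (M.of.comp (β none))
    (M.of_injective.comp hα) (M.of_injective.comp hβ)
  of := (HNN.of _ _ _ _).comp M.of
  r i := i.elim (HNN.t _ _ _ _) fun i => HNN.of _ _ _ _ (M.r i)
  of_injective := (HNN.of_injective _ _ _ _).comp M.of_injective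
  rel i c := by
    cases i with
    | none => exact HNN.t_mul (M.of.comp (α none)) (M.of.comp (β none)) _ _ c
    | some i =>
      have := congrArg (HNN.of (M.of.comp (α none)) (M.of.comp (β none))
        (M.of_injective.comp hα) (M.of_injective.comp hβ)) (M.rel i c)
      simpa using this
  exists_lift f s h := by
    obtain ⟨F, h1, h2⟩ := M.exists_lift f (fun i => s (some i)) fun i => h (some i)
    obtain ⟨F', h1', h2'⟩ := HNN.exists_lift (M.of.comp (α none)) (M.of.comp (β none))
      (M.of_injective.comp hα) (M.of_injective.comp hβ) F (s none) (by simpa [h1] using h none)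
    refine ⟨F', by simp [h1', h1], fun i => ?_⟩
    cases i with
    | none => exact h2'
    | some i => exact (h1' _).trans (h2 i)
  torsionFree h := HNN.torsionFree _ _ _ _ (M.torsionFree h)
  mem_of_of_mem_closure H hH k hk := by
    set L := Subgroup.closure (M.of '' H ∪ Set.range M.r)
    have hL : ∀ k, M.of k ∈ L ↔ k ∈ H := fun k =>
      ⟨M.mem_of_of_mem_closure H (fun i => hH (some i)) k,
        fun h => Subgroup.subset_closure (Or.inl ⟨k, h, rfl⟩)⟩
    rw [← hL]
    refine HNN.mem_of_of_mem_closure (M.of.comp (α none)) (M.of.comp (β none))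
      (M.of_injective.comp hα) (M.of_injective.comp hβ) L ?_ ?_
    · intro c
      simpa [hL] using hH none c
    · refine (Subgroup.closure_le _).2 ?_ hk
      rintro _ (⟨h, hh, rfl⟩ | ⟨i, rfl⟩)
      · exact Subgroup.subset_closure (Or.inl ⟨M.of h, (hL h).2 hh, rfl⟩)
      · cases i with
        | none => exact Subgroup.subset_closure (Or.inr rfl)
        | some i =>
          exact Subgroup.subset_closure
            (Or.inl ⟨M.r i, Subgroup.subset_closure (Or.inr ⟨i, rfl⟩), rfl⟩)
  closure_eq_top := by
    rw [eq_top_iff, ← HNN.closure_eq_top, Subgroup.closure_le]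
    rintro _ (⟨g, rfl⟩ | rfl)
    · have hg : g ∈ Subgroup.closure (Set.range M.of ∪ Set.range M.r) := by
        rw [M.closure_eq_top]; trivial
      rw [SetLike.mem_coe, ← Subgroup.mem_comap]
      refine (Subgroup.closure_le _).2 ?_ hg
      rintro _ (⟨k, rfl⟩ | ⟨i, rfl⟩)
      · exact Subgroup.subset_closure (Or.inl ⟨k, rfl⟩)
      · exact Subgroup.subset_closure (Or.inr ⟨some i, rfl⟩)
    · exact Subgroup.subset_closure (Or.inr ⟨none, rfl⟩)

theorem nonempty {ι : Type} [Finite ι] (α β : ι → C →* K)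
    (hα : ∀ i, Function.Injective (α i)) (hβ : ∀ i, Function.Injective (β i)) :
    Nonempty (MultiHNN α β) := by
  refine Finite.induction_empty_option (P := fun ι => ∀ α β : ι → C →* K,
    (∀ i, Function.Injective (α i)) → (∀ i, Function.Injective (β i)) →
    Nonempty (MultiHNN α β)) ?_ ?_ ?_ ι α β hα hβ
  · intro ι κ e ih α β hα hβ
    exact (ih (fun i => α (e i)) (fun i => β (e i)) (fun _ => hα _) fun _ => hβ _).map (reindex e)
  · exact fun α β _ _ => ⟨empty α β⟩
  · intro ι _ ih α β hα hβ
    exact (ih (fun i => α (some i)) (fun i => β (some i)) (fun _ => hα _) fun _ => hβ _).map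
      fun M => option M (hα _) (hβ _)

variable {ι : Type} {α β : ι → C →* K} (M : MultiHNN α β)

theorem exists_retract : ∃ F : M.G →* FreeGroup ι, ∀ i, F (M.r i) = FreeGroup.of i := by
  obtain ⟨F, -, h⟩ := M.exists_lift (1 : K →* FreeGroup ι) FreeGroup.of (by simp)
  exact ⟨F, h⟩

theorem injective_lift_r : Function.Injective (FreeGroup.lift M.r) := by
  obtain ⟨F, h⟩ := M.exists_retract
  have : F.comp (FreeGroup.lift M.r) = MonoidHom.id _ := by ext; simp [h]
  exact Function.LeftInverse.injective (g := F) fun x => DFunLike.congr_fun this x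

theorem r_ne_one (i : ι) : M.r i ≠ 1 := by
  obtain ⟨F, h⟩ := M.exists_retract
  intro e
  have := h i
  rw [e, map_one] at this
  exact FreeGroup.of_ne_one i this.symm

theorem eq_one_of_mem_closure_r (hα : ∀ i, Function.Injective (α i))
    (hβ : ∀ i, Function.Injective (β i)) {k : K}
    (hk : M.of k ∈ Subgroup.closure (Set.range M.r)) : k = 1 := by
  rw [← Subgroup.mem_bot]
  refine M.mem_of_of_mem_closure ⊥ (fun i c => ?_) k
    (Subgroup.closure_mono Set.subset_union_right hk)
  rw [Subgroup.mem_bot, Subgroup.mem_bot, map_eq_one_iff _ (hα i), map_eq_one_iff _ (hβ i)]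

end MultiHNN

section Amalgam

variable {A B C P : Type} [Group A] [Group B] [Group C] [Group P]

/-- Every element generated by `f₁ A` and `f₂ B`, amalgamated along `C`, is an alternating
product of elements outside `C`. -/
theorem exists_alternating (i : C →* A) (j : C →* B) (f₁ : A →* P) (f₂ : B →* P)
    (hf : ∀ c, f₁ (i c) = f₂ (j c)) {x : P}
    (hx : x ∈ Subgroup.closure (Set.range f₁ ∪ Set.range f₂)) :
    ∃ (b : B) (l : List (A × B)), (∀ q ∈ l, q.1 ∉ Set.range i) ∧
      l.IsChain (fun q _ => q.2 ∉ Set.range j) ∧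
      x = f₂ b * (l.map fun q => f₁ q.1 * f₂ q.2).prod := by
  have left : ∀ y : P, (∃ (b : B) (l : List (A × B)), (∀ q ∈ l, q.1 ∉ Set.range i) ∧
      l.IsChain (fun q _ => q.2 ∉ Set.range j) ∧
      y = f₂ b * (l.map fun q => f₁ q.1 * f₂ q.2).prod) → ∀ a, ∃ (b : B) (l : List (A × B)),
      (∀ q ∈ l, q.1 ∉ Set.range i) ∧ l.IsChain (fun q _ => q.2 ∉ Set.range j) ∧
      f₁ a * y = f₂ b * (l.map fun q => f₁ q.1 * f₂ q.2).prod := by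
    rintro _ ⟨b, l, h1, h2, rfl⟩ a
    by_cases ha : a ∈ Set.range i
    · obtain ⟨c, rfl⟩ := ha
      exact ⟨j c * b, l, h1, h2, by simp [hf, mul_assoc]⟩
    cases l with
    | nil => exact ⟨1, [(a, b)], by simpa using ha, by simp, by simp⟩
    | cons q l =>
      by_cases hb : b ∈ Set.range j
      · obtain ⟨c, rfl⟩ := hb
        by_cases ha' : a * i c * q.1 ∈ Set.range i
        · obtain ⟨c', hc'⟩ := ha'
          refine ⟨j c' * q.2, l, fun q hq => h1 q (List.mem_cons_of_mem _ hq), h2.tail, ?_⟩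
          rw [map_mul, ← hf c', hc', ← hf]
          simp [mul_assoc]
        · refine ⟨1, (a * i c * q.1, q.2) :: l, ?_, ?_, ?_⟩
          · simp only [List.mem_cons, forall_eq_or_imp]
            exact ⟨ha', fun q hq => h1 q (List.mem_cons_of_mem _ hq)⟩
          · rw [List.isChain_cons] at h2 ⊢
            exact h2
          · simp [← hf, mul_assoc]
      · refine ⟨1, (a, b) :: q :: l, ?_, ?_, ?_⟩
        · rw [List.forall_mem_cons]
          exact ⟨ha, h1⟩
        · rw [List.isChain_cons_cons]
          exact ⟨hb, h2⟩
        · simp [mul_assoc]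
  induction hx using Subgroup.closure_induction_left with
  | one => exact ⟨1, [], by simp, by simp, by simp⟩
  | mul_left x hx y _ ih =>
    rcases hx with ⟨g, rfl⟩ | ⟨g, rfl⟩
    · exact left y ih g
    · obtain ⟨b, l, h1, h2, rfl⟩ := ih
      exact ⟨g * b, l, h1, h2, by simp [mul_assoc]⟩
  | inv_mul_cancel x hx y _ ih =>
    rcases hx with ⟨g, rfl⟩ | ⟨g, rfl⟩
    · rw [← map_inv]
      exact left y ih _
    · obtain ⟨b, l, h1, h2, rfl⟩ := ih
      exact ⟨g⁻¹ * b, l, h1, h2, by simp [mul_assoc]⟩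

/-- A group with the universal property of an amalgamated product of torsion-free groups is
torsion-free and contains the first factor. -/
theorem torsionFree_amalgam (i : C →* A) (j : C →* B) (hi : Function.Injective i)
    (hj : Function.Injective j) (hA : TorsionFree A) (hB : TorsionFree B)
    (f₁ : A →* P) (f₂ : B →* P) (hf : ∀ c, f₁ (i c) = f₂ (j c))
    (hgen : Subgroup.closure (Set.range f₁ ∪ Set.range f₂) = ⊤)
    (huniv : ∀ {M : Type} [Group M] (g₁ : A →* M) (g₂ : B →* M), (∀ c, g₁ (i c) = g₂ (j c)) →
      ∃ F : P →* M, (∀ a, F (f₁ a) = g₁ a) ∧ ∀ b, F (f₂ b) = g₂ b) :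
    TorsionFree P ∧ Function.Injective f₁ := by
  let α : C →* A × B := (MonoidHom.inl A B).comp i
  let β : C →* A × B := (MonoidHom.inr A B).comp j
  have hα : Function.Injective α := fun _ _ h => hi (congrArg Prod.fst h)
  have hβ : Function.Injective β := fun _ _ h => hj (congrArg Prod.snd h)
  set o := HNN.of α β hα hβ with ho
  set τ := HNN.t α β hα hβ with hτ
  obtain ⟨Φ, h₁, h₂⟩ := huniv
    ((MulAut.conj τ).toMonoidHom.comp (o.comp (MonoidHom.inl A B))) (o.comp (MonoidHom.inr A B))
    (fun c => by
      have : τ * o (i c, 1) = o (1, j c) * τ := HNN.t_mul α β hα hβ c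
      simp [this])
  have hΦ : Function.Injective Φ := by
    rw [injective_iff_map_eq_one]
    intro x hx
    obtain ⟨b, l, h1, h2, rfl⟩ := exists_alternating i j f₁ f₂ hf
      (show x ∈ _ by rw [hgen]; trivial)
    let E : List (A × B) → List (ℤˣ × (A × B)) :=
      List.flatMap fun q => [(1, (q.1, 1)), (-1, (1, q.2))]
    have hE : ∀ l : List (A × B), Φ (l.map fun q => f₁ q.1 * f₂ q.2).prod
        = letterProd o τ (E l) := by
      intro l
      induction l with
      | nil => simp [E]
      | cons q l ih =>
        simp only [List.map_cons, List.prod_cons, map_mul, ih, h₁, h₂]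
        simp [E, mul_assoc]
    have hch : (E l).IsChain (NoPinch (hnnSide α β)) := by
      clear hx
      induction l with
      | nil => simp [E]
      | cons q l ih =>
        have ih := ih (fun q hq => h1 q (List.mem_cons_of_mem _ hq)) h2.tail
        change List.IsChain _ ((1, (q.1, 1)) :: (-1, (1, q.2)) :: E l)
        rw [List.isChain_cons_cons, List.isChain_cons]
        refine ⟨fun h => (h1 q (by simp) ?_).elim, ?_, ih⟩
        · obtain ⟨c, hc⟩ : (q.1, (1 : B)) ∈ Set.range α := by simpa [hnnSide] using h
          exact ⟨c, congrArg Prod.fst hc⟩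
        · cases l with
          | nil => simp [E]
          | cons q' l =>
            intro y _ h
            refine ((List.isChain_cons_cons.1 h2).1 ?_).elim
            obtain ⟨c, hc⟩ : ((1 : A), q.2) ∈ Set.range β := by simpa [hnnSide] using h
            exact ⟨c, congrArg Prod.snd hc⟩
    rw [map_mul, hE, h₂] at hx
    have hnil := HNN.eq_nil_of_isChain α β hα hβ hch (k := 1) (hx.trans (map_one _).symm)
    have : l = [] := by
      cases l with
      | nil => rfl
      | cons => simp [E] at hnil
    subst this
    simp only [E, List.flatMap_nil, letterProd_nil, mul_one] at hx
    have hb : (MonoidHom.inr A B) b = 1 := HNN.of_injective α β hα hβ (hx.trans (map_one _).symm)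
    have : b = 1 := congrArg Prod.snd hb
    simp [this]
  refine ⟨(HNN.torsionFree α β hα hβ (hA.prod hB)).of_injective Φ hΦ, ?_⟩
  refine Function.Injective.of_comp (f := Φ) ?_
  have : Φ ∘ f₁ = (MulAut.conj τ) ∘ o ∘ (MonoidHom.inl A B) := funext fun a => h₁ a
  rw [this]
  exact (MulAut.conj τ).injective.comp
    ((HNN.of_injective α β hα hβ).comp fun _ _ h => congrArg Prod.fst h)

end Amalgam

section Base

/-- The action of the additive group `ℤ × ℤ` on the free group on itself by translation. -/
def shift : Multiplicative (ℤ × ℤ) →* MulAut (FreeGroup (ℤ × ℤ)) where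
  toFun v := FreeGroup.freeGroupCongr (Equiv.addLeft v.toAdd)
  map_one' := by
    apply MulEquiv.toMonoidHom_injective
    ext
    simp
  map_mul' v w := by
    apply MulEquiv.toMonoidHom_injective
    ext
    simp [add_assoc]

@[simp]
theorem shift_of (v : Multiplicative (ℤ × ℤ)) (u : ℤ × ℤ) :
    shift v (FreeGroup.of u) = FreeGroup.of (v.toAdd + u) := by
  simp [shift]

/-- The group generated by a free group on elements `t v`, for `v : ℤ × ℤ`, and by a copy of
`ℤ × ℤ` permuting these by translation. -/
abbrev BaseGroup : Type := FreeGroup (ℤ × ℤ) ⋊[shift] Multiplicative (ℤ × ℤ)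

/-- The product `X ^ v.1 * Y ^ v.2`. -/
def monomial {M : Type*} [Group M] (X Y : M) (v : ℤ × ℤ) : M := X ^ v.1 * Y ^ v.2

/-- The conjugate of `T` by the monomial with exponents `v`. -/
def conjPoint {M : Type*} [Group M] (X Y T : M) (v : ℤ × ℤ) : M :=
  monomial X Y v * T * (monomial X Y v)⁻¹

theorem map_monomial {M N : Type*} [Group M] [Group N] (f : M →* N) (X Y : M) (v : ℤ × ℤ) :
    f (monomial X Y v) = monomial (f X) (f Y) v := by simp [monomial]

theorem map_conjPoint {M N : Type*} [Group M] [Group N] (f : M →* N) (X Y T : M) (v : ℤ × ℤ) :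
    f (conjPoint X Y T v) = conjPoint (f X) (f Y) (f T) v := by simp [conjPoint, map_monomial]

theorem monomial_add {M : Type*} [Group M] {X Y : M} (h : Commute X Y) (v w : ℤ × ℤ) :
    monomial X Y (v + w) = monomial X Y v * monomial X Y w := by
  simp only [monomial, Prod.fst_add, Prod.snd_add, zpow_add]
  rw [mul_assoc, mul_assoc, ← mul_assoc (X ^ w.1), ((h.zpow_zpow w.1 v.2).eq), mul_assoc]

theorem conjPoint_add {M : Type*} [Group M] {X Y : M} (h : Commute X Y) (T : M) (v w : ℤ × ℤ) :
    conjPoint X Y T (v + w) = monomial X Y v * conjPoint X Y T w * (monomial X Y v)⁻¹ := by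
  simp [conjPoint, monomial_add h, mul_assoc]

namespace BaseGroup

/-- The free generators. -/
def t (v : ℤ × ℤ) : BaseGroup := SemidirectProduct.inl (FreeGroup.of v)

/-- The translations. -/
def e (v : ℤ × ℤ) : BaseGroup := SemidirectProduct.inr (Multiplicative.ofAdd v)

theorem torsionFree : TorsionFree BaseGroup := by
  intro g n hn h
  have key : ∀ g : BaseGroup, ∀ n : ℕ, (g ^ n).right = g.right ^ n := fun g n =>
    map_pow (SemidirectProduct.rightHom (φ := shift)) g n
  have hr : g.right = 1 := by
    have : g.right ^ n = 1 := by rw [← key, h]; rfl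
    exact (pow_eq_one_iff_left hn.ne').1 this
  have hg : g = SemidirectProduct.inl g.left := by ext <;> simp [hr]
  rw [hg, ← map_pow, map_eq_one_iff _ SemidirectProduct.inl_injective,
    pow_eq_one_iff_left hn.ne'] at h
  rw [hg, h, map_one]

theorem t_ne_one (v : ℤ × ℤ) : t v ≠ 1 := by
  rw [t, Ne, map_eq_one_iff _ SemidirectProduct.inl_injective]
  exact FreeGroup.of_ne_one v

theorem e_ne_one {v : ℤ × ℤ} (hv : v ≠ 0) : e v ≠ 1 := by
  rw [e, Ne, map_eq_one_iff _ SemidirectProduct.inr_injective]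
  exact hv

theorem e_eq (v : ℤ × ℤ) : e v = monomial (e (1, 0)) (e (0, 1)) v := by
  simp only [monomial, e, ← map_zpow, ← map_mul, ← ofAdd_zsmul, ← ofAdd_add]
  congr 2
  ext <;> simp

theorem t_eq (v : ℤ × ℤ) : t v = conjPoint (e (1, 0)) (e (0, 1)) (t 0) v := by
  rw [conjPoint, ← e_eq, t, e, ← map_inv, t, ← SemidirectProduct.inl_aut]
  simp

theorem commute_e (v w : ℤ × ℤ) : Commute (e v) (e w) :=
  (Commute.all _ _).map SemidirectProduct.inr

theorem exists_lift {M : Type} [Group M] {X Y : M} (h : Commute X Y) (T : M) :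
    ∃ F : BaseGroup →* M, F (e (1, 0)) = X ∧ F (e (0, 1)) = Y ∧ F (t 0) = T := by
  let φ : Multiplicative (ℤ × ℤ) →* M :=
    { toFun := fun v => monomial X Y v.toAdd
      map_one' := by simp [monomial]
      map_mul' := fun v w => monomial_add h _ _ }
  refine ⟨SemidirectProduct.lift (FreeGroup.lift (conjPoint X Y T)) φ fun v => ?_, ?_, ?_, ?_⟩
  · ext u
    simp [conjPoint_add h, φ]
  · simp [e, φ, monomial]
  · simp [e, φ, monomial]
  · simp [t, conjPoint, monomial]

theorem hom_ext {M : Type} [Group M] {f g : BaseGroup →* M} (hX : f (e (1, 0)) = g (e (1, 0)))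
    (hY : f (e (0, 1)) = g (e (0, 1))) (hT : f (t 0) = g (t 0)) : f = g := by
  apply SemidirectProduct.hom_ext
  · apply FreeGroup.ext_hom
    intro v
    change f (t v) = g (t v)
    rw [t_eq, map_conjPoint, map_conjPoint, hX, hY, hT]
  · ext v
    change f (e v) = g (e v)
    rw [e_eq, map_monomial, map_monomial, hX, hY]

/-- The endomorphism induced by the affine map `u ↦ m * u + a`. -/
def affine (m a : ℤ × ℤ) : BaseGroup →* BaseGroup :=
  SemidirectProduct.map (FreeGroup.map fun u => m * u + a)
    (AddMonoidHom.toMultiplicative (AddMonoidHom.mulLeft m)) fun v => by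
      ext u
      simp [mul_add, add_assoc]

variable {m a m' a' : ℤ × ℤ}

theorem affine_t (u : ℤ × ℤ) : affine m a (t u) = t (m * u + a) := by simp [affine, t]

theorem affine_e (u : ℤ × ℤ) : affine m a (e u) = e (m * u) := by simp [affine, e]

theorem affine_injective (hm : Function.Injective (m * ·)) :
    Function.Injective (affine m a) := by
  intro x y h
  have hl := congrArg SemidirectProduct.left h
  have hr := congrArg SemidirectProduct.right h
  exact SemidirectProduct.ext (FreeGroup.map_injective (f := fun u => m * u + a)
    (fun u v h => hm (add_right_cancel h)) hl) (hm hr)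

/-- The subgroup generated by the `t v` with `v ∈ S`. -/
def pointSubgroup (S : Set (ℤ × ℤ)) : Subgroup BaseGroup := Subgroup.closure (t '' S)

theorem t_mem_pointSubgroup {S : Set (ℤ × ℤ)} {v : ℤ × ℤ} : t v ∈ pointSubgroup S ↔ v ∈ S := by
  refine ⟨fun h => ?_, fun h => Subgroup.subset_closure ⟨v, h, rfl⟩⟩
  by_contra hv
  classical
  have hmap : pointSubgroup S = (Subgroup.closure (FreeGroup.of '' S)).map
      (SemidirectProduct.inl (φ := shift)) := by
    rw [MonoidHom.map_closure, ← Set.image_comp]; rfl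
  rw [hmap] at h
  obtain ⟨x, hx, hxv⟩ := h
  rw [SemidirectProduct.inl_injective hxv] at hx
  let f : FreeGroup (ℤ × ℤ) →* Multiplicative ℤ :=
    FreeGroup.lift fun u => if u = v then Multiplicative.ofAdd 1 else 1
  have hf : Subgroup.closure (FreeGroup.of '' S) ≤ f.ker := by
    rw [Subgroup.closure_le]
    rintro _ ⟨u, hu, rfl⟩
    have : u ≠ v := fun h => hv (h ▸ hu)
    simp [f, MonoidHom.mem_ker, this]
  have := hf hx
  simp [f, MonoidHom.mem_ker] at this

theorem affine_mem_pointSubgroup (hm : Function.Injective (m * ·)) {S : Set (ℤ × ℤ)}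
    {x : BaseGroup} : affine m a x ∈ pointSubgroup S ↔
      x ∈ pointSubgroup ((fun u => m * u + a) ⁻¹' S) := by
  classical
  have hmap : ∀ S, pointSubgroup S = (Subgroup.closure (FreeGroup.of '' S)).map
      (SemidirectProduct.inl (φ := shift)) := by
    intro S
    rw [MonoidHom.map_closure, ← Set.image_comp]; rfl
  have hinj : Function.Injective fun u => m * u + a := fun u v h => hm (add_right_cancel h)
  constructor
  · intro h
    rw [hmap] at h ⊢
    obtain ⟨y, hy, hxy⟩ := h
    have hr : x.right = 1 := by
      have := congrArg SemidirectProduct.right hxy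
      exact hm (this.symm.trans (mul_zero m).symm)
    have hl : FreeGroup.map (fun u => m * u + a) x.left = y :=
      (congrArg SemidirectProduct.left hxy).symm
    refine ⟨x.left, ?_, by ext <;> simp [hr]⟩
    let f : FreeGroup (ℤ × ℤ) →* FreeGroup (ℤ × ℤ) := FreeGroup.lift fun v =>
      if h : ∃ u, m * u + a = v then FreeGroup.of h.choose else 1
    have hof : ∀ u, f (FreeGroup.of (m * u + a)) = FreeGroup.of u := by
      intro u
      have h : ∃ u', m * u' + a = m * u + a := ⟨u, rfl⟩
      have h' : h.choose = u := hinj h.choose_spec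
      simp only [f, FreeGroup.lift_apply_of]
      rw [dif_pos h, h']
    have hf : f (FreeGroup.map (fun u => m * u + a) x.left) = x.left := by
      have : f.comp (FreeGroup.map fun u => m * u + a) = MonoidHom.id _ := by
        ext u; simp [hof]
      exact DFunLike.congr_fun this _
    rw [← hf, hl, SetLike.mem_coe, ← Subgroup.mem_comap]
    refine (Subgroup.closure_le _).2 ?_ hy
    rintro _ ⟨v, hv, rfl⟩
    by_cases h : ∃ u, m * u + a = v
    · obtain ⟨u, rfl⟩ := h
      rw [SetLike.mem_coe, Subgroup.mem_comap, hof]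
      exact Subgroup.subset_closure ⟨u, hv, rfl⟩
    · have : f (FreeGroup.of v) = 1 := by
        simp only [f, FreeGroup.lift_apply_of]
        rw [dif_neg h]
      rw [SetLike.mem_coe, Subgroup.mem_comap, this]
      exact one_mem _
  · intro h
    rw [← Subgroup.mem_comap]
    refine (Subgroup.closure_le _).2 ?_ h
    rintro _ ⟨u, hu, rfl⟩
    rw [SetLike.mem_coe, Subgroup.mem_comap, affine_t]
    exact t_mem_pointSubgroup.2 hu

end BaseGroup

end Base

section PointGroup

/-- A rule identifies the points `m * u + a` and `m' * u + a'` of `ℤ × ℤ`, for all `u`. -/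
structure Rule where
  /-- The multiplier of the source. -/
  m : ℤ × ℤ
  /-- The offset of the source. -/
  a : ℤ × ℤ
  /-- The multiplier of the target. -/
  m' : ℤ × ℤ
  /-- The offset of the target. -/
  a' : ℤ × ℤ
  injective_m : Function.Injective (m * ·)
  injective_m' : Function.Injective (m' * ·)

/-- A set of points is closed under a rule if it does not separate identified points. -/
def Rule.Closed (ρ : Rule) (S : Set (ℤ × ℤ)) : Prop :=
  ∀ u, ρ.m * u + ρ.a ∈ S ↔ ρ.m' * u + ρ.a' ∈ S

/-- The generators of the group associated with a family of rules. -/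
inductive PointGen (ι : Type) : Type
  | X : PointGen ι
  | Y : PointGen ι
  | T : PointGen ι
  | K : PointGen ι
  | r (i : ι) : PointGen ι

instance PointGen.finite {ι : Type} [Finite ι] : Finite (PointGen ι) :=
  Finite.of_surjective (fun x : Fin 4 ⊕ ι => x.elim ![X, Y, T, K] r) fun
    | X => ⟨.inl 0, rfl⟩
    | Y => ⟨.inl 1, rfl⟩
    | T => ⟨.inl 2, rfl⟩
    | K => ⟨.inl 3, rfl⟩
    | r i => ⟨.inr i, rfl⟩

open PointGen
open scoped commutatorElement

variable {ι : Type}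

/-- The word expressing that `K` commutes with the conjugate of `T` given by `v`. -/
def pointWord (ι : Type) (v : ℤ × ℤ) : FreeGroup (PointGen ι) :=
  ⁅FreeGroup.of (K : PointGen ι), conjPoint (FreeGroup.of X) (FreeGroup.of Y) (FreeGroup.of T) v⁆

/-- The relators of the group associated with a family of rules and a base point. -/
def pointRels (ρ : ι → Rule) (v₀ : ℤ × ℤ) : Set (FreeGroup (PointGen ι)) :=
  {⁅FreeGroup.of (X : PointGen ι), FreeGroup.of Y⁆, pointWord ι v₀} ∪
    Set.range (fun i => ⁅FreeGroup.of (K : PointGen ι), FreeGroup.of (r i)⁆) ∪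
    Set.range (fun i => FreeGroup.of (r i) * FreeGroup.of X ^ (ρ i).m.1 *
      (FreeGroup.of (r i))⁻¹ * (FreeGroup.of X ^ (ρ i).m'.1)⁻¹) ∪
    Set.range (fun i => FreeGroup.of (r i) * FreeGroup.of Y ^ (ρ i).m.2 *
      (FreeGroup.of (r i))⁻¹ * (FreeGroup.of Y ^ (ρ i).m'.2)⁻¹) ∪
    Set.range (fun i => FreeGroup.of (r i) *
      conjPoint (FreeGroup.of X) (FreeGroup.of Y) (FreeGroup.of T) (ρ i).a *
      (FreeGroup.of (r i))⁻¹ *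
      (conjPoint (FreeGroup.of X) (FreeGroup.of Y) (FreeGroup.of T) (ρ i).a')⁻¹)

theorem pointRels_finite [Finite ι] (ρ : ι → Rule) (v₀ : ℤ × ℤ) : (pointRels ρ v₀).Finite :=
  (((((Set.toFinite _).union (Set.finite_range _)).union (Set.finite_range _)).union
    (Set.finite_range _)).union (Set.finite_range _))

theorem mul_inv_mul_inv_eq_one {G : Type*} [Group G] {a b c : G} :
    a * b * a⁻¹ * c⁻¹ = 1 ↔ a * b = c * a := by
  rw [mul_inv_eq_one, mul_inv_eq_iff_eq_mul]

theorem lift_pointRels {M : Type*} [Group M] (ρ : ι → Rule) (v₀ : ℤ × ℤ) (f : PointGen ι → M) :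
    (∀ x ∈ pointRels ρ v₀, FreeGroup.lift f x = 1) ↔
      Commute (f X) (f Y) ∧ Commute (f K) (conjPoint (f X) (f Y) (f T) v₀) ∧
      (∀ i, Commute (f K) (f (r i))) ∧
      (∀ i, f (r i) * f X ^ (ρ i).m.1 = f X ^ (ρ i).m'.1 * f (r i)) ∧
      (∀ i, f (r i) * f Y ^ (ρ i).m.2 = f Y ^ (ρ i).m'.2 * f (r i)) ∧
      (∀ i, f (r i) * conjPoint (f X) (f Y) (f T) (ρ i).a =
        conjPoint (f X) (f Y) (f T) (ρ i).a' * f (r i)) := by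
  simp only [pointRels, pointWord, Set.mem_union, or_imp, forall_and, Set.forall_mem_range,
    Set.mem_insert_iff, Set.mem_singleton_iff, forall_eq, map_mul, map_inv, map_zpow,
    map_commutatorElement, map_conjPoint, FreeGroup.lift_apply_of,
    commutatorElement_eq_one_iff_commute, mul_inv_mul_inv_eq_one, and_assoc]

/-- The HNN extension of `G` whose stable letter centralizes `L`. -/
abbrev CentralizingHNN {G : Type} [Group G] (L : Subgroup G) : Type :=
  HNN L.subtype L.subtype L.subtype_injective L.subtype_injective

theorem HNN.mem_of_commute {G : Type} [Group G] (L : Subgroup G) {g : G}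
    (h : Commute (HNN.t L.subtype L.subtype L.subtype_injective L.subtype_injective)
      (HNN.of _ _ _ _ g)) : g ∈ L := by
  by_contra hg
  have := HNN.eq_nil_of_isChain L.subtype L.subtype L.subtype_injective L.subtype_injective
    (l := [(1, g), (-1, 1)]) (g := 1) (k := g) ?_ ?_
  · simp at this
  · simpa [NoPinch, hnnSide] using hg
  · have h' := h.eq
    simp only [letterProd_cons, letterProd_nil]
    simp [h']

variable (ρ : ι → Rule) (v₀ : ℤ × ℤ)

theorem exists_pointGroup_model [Finite ι] {S : Set (ℤ × ℤ)} (hS : ∀ i, (ρ i).Closed S)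
    (hv₀ : v₀ ∈ S) :
    TorsionFree (PresentedGroup (pointRels ρ v₀)) ∧
    (∀ g, (PresentedGroup.of g : PresentedGroup (pointRels ρ v₀)) ≠ 1) ∧
    ∀ v, PresentedGroup.mk (pointRels ρ v₀) (pointWord ι v) = 1 → v ∈ S := by
  obtain ⟨M⟩ := MultiHNN.nonempty (fun i => BaseGroup.affine (ρ i).m (ρ i).a)
    (fun i => BaseGroup.affine (ρ i).m' (ρ i).a')
    (fun i => BaseGroup.affine_injective (ρ i).injective_m)
    fun i => BaseGroup.affine_injective (ρ i).injective_m'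
  let L : Subgroup M.G := Subgroup.closure ({M.of (BaseGroup.t v₀)} ∪ Set.range M.r)
  have hL : ∀ v, M.of (BaseGroup.t v) ∈ L → v ∈ S := by
    intro v hv
    rw [← BaseGroup.t_mem_pointSubgroup]
    refine M.mem_of_of_mem_closure _ (fun i c => ?_) _ (Subgroup.closure_mono ?_ hv)
    · rw [BaseGroup.affine_mem_pointSubgroup (ρ i).injective_m,
        BaseGroup.affine_mem_pointSubgroup (ρ i).injective_m']
      exact iff_of_eq (congrArg (fun S => c ∈ BaseGroup.pointSubgroup S) (Set.ext (hS i)))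
    · refine Set.union_subset_union_left _ (Set.singleton_subset_iff.2 ?_)
      exact ⟨_, BaseGroup.t_mem_pointSubgroup.2 hv₀, rfl⟩
  let o : M.G →* CentralizingHNN L :=
    HNN.of L.subtype L.subtype L.subtype_injective L.subtype_injective
  let κ : CentralizingHNN L := HNN.t L.subtype L.subtype L.subtype_injective L.subtype_injective
  have ho : Function.Injective o := HNN.of_injective _ _ _ _
  have hκ : ∀ g ∈ L, Commute κ (o g) := fun g hg => HNN.t_mul L.subtype L.subtype _ _ ⟨g, hg⟩
  let b : BaseGroup →* CentralizingHNN L := o.comp M.of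
  have hb : Function.Injective b := ho.comp M.of_injective
  let f : PointGen ι → CentralizingHNN L := fun
    | X => b (BaseGroup.e (1, 0))
    | Y => b (BaseGroup.e (0, 1))
    | T => b (BaseGroup.t 0)
    | K => κ
    | r i => o (M.r i)
  have hpt : ∀ v, conjPoint (f X) (f Y) (f T) v = b (BaseGroup.t v) := fun v => by
    rw [BaseGroup.t_eq, map_conjPoint]
  have hr : ∀ i c, o (M.r i) * b (BaseGroup.affine (ρ i).m (ρ i).a c) =
      b (BaseGroup.affine (ρ i).m' (ρ i).a' c) * o (M.r i) := fun i c => by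
    simpa [b] using congrArg o (M.rel i c)
  have hX : ∀ n : ℤ, f X ^ n = b (BaseGroup.e (n, 0)) := fun n => by
    rw [BaseGroup.e_eq (n, 0), map_monomial]
    simp [f, monomial]
  have hY : ∀ n : ℤ, f Y ^ n = b (BaseGroup.e (0, n)) := fun n => by
    rw [BaseGroup.e_eq (0, n), map_monomial]
    simp [f, monomial]
  have hrel : ∀ x ∈ pointRels ρ v₀, FreeGroup.lift f x = 1 := by
    rw [lift_pointRels]
    refine ⟨(BaseGroup.commute_e _ _).map b, ?_, fun i => ?_, fun i => ?_, fun i => ?_, fun i => ?_⟩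
    · rw [hpt]
      exact hκ _ (Subgroup.subset_closure (Or.inl rfl))
    · exact hκ _ (Subgroup.subset_closure (Or.inr ⟨i, rfl⟩))
    · have := hr i (BaseGroup.e (1, 0))
      rw [BaseGroup.affine_e, BaseGroup.affine_e] at this
      simpa [hX, Prod.mul_def] using this
    · have := hr i (BaseGroup.e (0, 1))
      rw [BaseGroup.affine_e, BaseGroup.affine_e] at this
      simpa [hY, Prod.mul_def] using this
    · have := hr i (BaseGroup.t 0)
      rw [BaseGroup.affine_t, BaseGroup.affine_t] at this
      simpa [hpt] using this
  let Φ : PresentedGroup (pointRels ρ v₀) →* CentralizingHNN L := PresentedGroup.toGroup hrel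
  have hΦ : ∀ g, Φ (PresentedGroup.of g) = f g := fun g => PresentedGroup.toGroup.of hrel
  have hΦi : Function.Injective Φ := by
    let q : PointGen ι → PresentedGroup (pointRels ρ v₀) := PresentedGroup.of
    have hq : ∀ x ∈ pointRels ρ v₀, FreeGroup.lift q x = 1 := by
      intro x hx
      have : FreeGroup.lift q = PresentedGroup.mk (pointRels ρ v₀) := by ext; simp [q]; rfl
      rw [this]
      exact PresentedGroup.one_of_mem hx
    obtain ⟨h1, h2, h3, h4, h5, h6⟩ := (lift_pointRels ρ v₀ q).1 hq
    obtain ⟨F, hFX, hFY, hFT⟩ := BaseGroup.exists_lift h1 (q T)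
    have hF : ∀ v, F (BaseGroup.t v) = conjPoint (q X) (q Y) (q T) v := fun v => by
      rw [BaseGroup.t_eq, map_conjPoint, hFX, hFY, hFT]
    have hFe : ∀ v, F (BaseGroup.e v) = monomial (q X) (q Y) v := fun v => by
      rw [BaseGroup.e_eq, map_monomial, hFX, hFY]
    obtain ⟨F', hF', hF'r⟩ := M.exists_lift F (fun i => q (r i)) (fun i => by
      have : ((MulAut.conj (q (r i))).toMonoidHom.comp F).comp
          (BaseGroup.affine (ρ i).m (ρ i).a) = F.comp (BaseGroup.affine (ρ i).m' (ρ i).a') := by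
        apply BaseGroup.hom_ext
        · simpa [BaseGroup.affine_e, hFe, monomial, mul_inv_eq_iff_eq_mul] using h4 i
        · simpa [BaseGroup.affine_e, hFe, monomial, mul_inv_eq_iff_eq_mul] using h5 i
        · simpa [BaseGroup.affine_t, hF, mul_inv_eq_iff_eq_mul] using h6 i
      intro c
      have := DFunLike.congr_fun this c
      simpa [mul_inv_eq_iff_eq_mul] using this)
    obtain ⟨F'', hF'', hF''κ⟩ := HNN.exists_lift L.subtype L.subtype L.subtype_injective
      L.subtype_injective F' (q K) (by
        have : L ≤ (Subgroup.centralizer {q K}).comap F' := by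
          refine (Subgroup.closure_le _).2 ?_
          rintro _ (rfl | ⟨i, rfl⟩)
          · rw [SetLike.mem_coe, Subgroup.mem_comap, hF', hF,
              Subgroup.mem_centralizer_singleton_iff]
            exact h2.eq.symm
          · rw [SetLike.mem_coe, Subgroup.mem_comap, hF'r, Subgroup.mem_centralizer_singleton_iff]
            exact (h3 i).eq.symm
        intro c
        exact (Subgroup.mem_centralizer_singleton_iff.1 (Subgroup.mem_comap.1 (this c.2))).symm)
    have : F''.comp Φ = MonoidHom.id _ := by
      apply PresentedGroup.ext
      intro g
      rw [MonoidHom.comp_apply, hΦ]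
      cases g with
      | X => exact ((hF'' _).trans (hF' _)).trans hFX
      | Y => exact ((hF'' _).trans (hF' _)).trans hFY
      | T => exact ((hF'' _).trans (hF' _)).trans hFT
      | K => exact hF''κ
      | r i => exact (hF'' _).trans (hF'r i)
    exact Function.LeftInverse.injective (g := F'') fun x => DFunLike.congr_fun this x
  refine ⟨(HNN.torsionFree _ _ _ _ (M.torsionFree BaseGroup.torsionFree)).of_injective Φ hΦi,
    fun g hg => ?_, fun v hv => ?_⟩
  · have hg' : f g = 1 := by rw [← hΦ, hg, map_one]
    cases g with
    | X => exact BaseGroup.e_ne_one (by simp) ((map_eq_one_iff b hb).1 hg')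
    | Y => exact BaseGroup.e_ne_one (by simp) ((map_eq_one_iff b hb).1 hg')
    | T => exact BaseGroup.t_ne_one _ ((map_eq_one_iff b hb).1 hg')
    | K =>
      have := HNN.eq_nil_of_isChain L.subtype L.subtype L.subtype_injective L.subtype_injective
        (l := [(1, 1)]) (g := 1) (k := 1) (by simp)
        (by simpa [letterProd_cons, letterProd_nil, f, κ] using hg')
      simp at this
    | r i => exact M.r_ne_one i ((map_eq_one_iff o ho).1 hg')
  · have : Φ (PresentedGroup.mk _ (pointWord ι v)) = ⁅κ, b (BaseGroup.t v)⁆ := by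
      rw [pointWord, map_commutatorElement, map_commutatorElement, map_conjPoint, map_conjPoint,
        ← hpt]
      change ⁅Φ (PresentedGroup.of K), conjPoint (Φ (PresentedGroup.of X))
        (Φ (PresentedGroup.of Y)) (Φ (PresentedGroup.of T)) v⁆ = _
      simp only [hΦ]
      rfl
    rw [hv, map_one, eq_comm, commutatorElement_eq_one_iff_commute] at this
    exact hL v (HNN.mem_of_commute L this)

theorem pointWord_eq_one {S : Set (ℤ × ℤ)}
    (hS : ∀ S' : Set (ℤ × ℤ), v₀ ∈ S' → (∀ i, (ρ i).Closed S') → S ⊆ S') {v : ℤ × ℤ}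
    (hv : v ∈ S) : PresentedGroup.mk (pointRels ρ v₀) (pointWord ι v) = 1 := by
  let q : PointGen ι → PresentedGroup (pointRels ρ v₀) := PresentedGroup.of
  have hq' : FreeGroup.lift q = PresentedGroup.mk (pointRels ρ v₀) := by ext; simp [q]; rfl
  have hq : ∀ x ∈ pointRels ρ v₀, FreeGroup.lift q x = 1 := by
    intro x hx
    rw [hq']
    exact PresentedGroup.one_of_mem hx
  obtain ⟨h1, h2, h3, h4, h5, h6⟩ := (lift_pointRels ρ v₀ q).1 hq
  rw [← hq', pointWord, map_commutatorElement, map_conjPoint,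
    commutatorElement_eq_one_iff_commute]
  simp only [FreeGroup.lift_apply_of]
  refine hS {v | Commute (q K) (conjPoint (q X) (q Y) (q T) v)} h2 (fun i u => ?_) hv
  have key : ∀ n : ℤ × ℤ, q (r i) * monomial (q X) (q Y) ((ρ i).m * n) * (q (r i))⁻¹ =
      monomial (q X) (q Y) ((ρ i).m' * n) := by
    intro n
    have e1 : MulAut.conj (q (r i)) (q X ^ (ρ i).m.1) = q X ^ (ρ i).m'.1 := by
      rw [MulAut.conj_apply, h4, mul_inv_cancel_right]
    have e2 : MulAut.conj (q (r i)) (q Y ^ (ρ i).m.2) = q Y ^ (ρ i).m'.2 := by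
      rw [MulAut.conj_apply, h5, mul_inv_cancel_right]
    rw [← MulAut.conj_apply]
    simp only [monomial, Prod.fst_mul, Prod.snd_mul, zpow_mul, map_mul]
    rw [map_zpow] at e1 e2
    simp only [map_zpow, e1, e2]
  have e3 : MulAut.conj (q (r i)) (conjPoint (q X) (q Y) (q T) ((ρ i).m * u + (ρ i).a)) =
      conjPoint (q X) (q Y) (q T) ((ρ i).m' * u + (ρ i).a') := by
    rw [conjPoint_add h1, conjPoint_add h1, map_mul, map_mul, map_inv, MulAut.conj_apply, key,
      MulAut.conj_apply, h6, mul_inv_cancel_right]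
  have e4 : MulAut.conj (q (r i)) (q K) = q K := by
    rw [MulAut.conj_apply, ← (h3 i).eq, mul_inv_cancel_right]
  simp only [Set.mem_ofPred_eq]
  rw [← e3]
  nth_rewrite 2 [← e4]
  exact (commute_map_iff (MulAut.conj (q (r i))).injective).symm

end PointGroup

section Rabin

theorem FreeGroup.lift_sq_injective {A : Type} :
    Function.Injective (FreeGroup.lift fun a : A => FreeGroup.of a ^ 2) := by
  classical
  rw [injective_iff_map_eq_one]
  intro x hx
  have hmk : ∀ L : List (A × Bool), FreeGroup.lift (fun a : A => FreeGroup.of a ^ 2)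
      (FreeGroup.mk L) = FreeGroup.mk (L.flatMap fun p => [p, p]) := by
    intro L
    induction L with
    | nil => rfl
    | cons p L ih =>
      rw [FreeGroup.lift_mk] at ih ⊢
      rw [List.map_cons, List.prod_cons, ih]
      rcases p with ⟨a, _ | _⟩
      · change (FreeGroup.of a ^ 2)⁻¹ * _ = FreeGroup.mk ([(a, false), (a, false)] ++ _)
        rw [← FreeGroup.mul_mk, pow_two, mul_inv_rev]
        rfl
      · change FreeGroup.of a ^ 2 * _ = FreeGroup.mk ([(a, true), (a, true)] ++ _)
        rw [← FreeGroup.mul_mk, pow_two]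
        rfl
  have hred : ∀ L : List (A × Bool), FreeGroup.IsReduced L →
      FreeGroup.IsReduced (L.flatMap fun p => [p, p]) := by
    intro L hL
    induction L with
    | nil => exact hL
    | cons p L ih =>
      have ih := ih hL.tail
      change List.IsChain _ (p :: p :: _)
      rw [List.isChain_cons_cons]
      refine ⟨fun _ => rfl, ?_⟩
      cases L with
      | nil => exact List.isChain_singleton _
      | cons q L => exact List.isChain_cons_cons.2 ⟨(List.isChain_cons_cons.1 hL).1, ih⟩
  have h := hred _ (FreeGroup.isReduced_toWord (x := x))
  rw [← FreeGroup.mk_toWord (x := x), hmk, ← FreeGroup.toWord_eq_nil_iff, FreeGroup.toWord_mk,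
    h.reduce_eq, List.flatMap_eq_nil_iff] at hx
  rw [← FreeGroup.toWord_eq_nil_iff, List.eq_nil_iff_forall_not_mem]
  intro p hp
  simpa using hx p hp

theorem MultiHNN.hom_ext {K C ι : Type} [Group K] [Group C] {α β : ι → C →* K}
    (M : MultiHNN α β) {N : Type} [Group N] {f g : M.G →* N} (h : ∀ k, f (M.of k) = g (M.of k))
    (h' : ∀ i, f (M.r i) = g (M.r i)) : f = g := by
  apply MonoidHom.eq_of_eqOn_dense M.closure_eq_top
  rintro _ (⟨k, rfl⟩ | ⟨i, rfl⟩)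
  · exact h k
  · exact h' i

/-- The generators of the Rabin group of a presentation with generators `A`. -/
inductive RabinGen (A : Type) : Type
  | base (a : A) : RabinGen A
  | y (a : A) : RabinGen A
  | z : RabinGen A
  | s : RabinGen A

instance RabinGen.finite {A : Type} [Finite A] : Finite (RabinGen A) :=
  Finite.of_surjective (fun x : (A ⊕ A) ⊕ Fin 2 => x.elim (Sum.elim base y) ![z, s]) fun
    | base a => ⟨.inl (.inl a), rfl⟩
    | y a => ⟨.inl (.inr a), rfl⟩
    | z => ⟨.inr 0, rfl⟩
    | s => ⟨.inr 1, rfl⟩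

open RabinGen
open scoped commutatorElement

/-- The relator expressing that `a` conjugates `b` to its square. -/
def sqRel {G : Type*} [Group G] (a b : G) : G := a * b * a⁻¹ * (b ^ 2)⁻¹

theorem sqRel_eq_one {G : Type*} [Group G] {a b : G} : sqRel a b = 1 ↔ a * b = b ^ 2 * a :=
  mul_inv_mul_inv_eq_one

theorem map_sqRel {G H : Type*} [Group G] [Group H] (f : G →* H) (a b : G) :
    f (sqRel a b) = sqRel (f a) (f b) := by simp [sqRel]

theorem mem_commutator_of_mul_eq {G : Type*} [Group G] {a b : G} (h : a * b = b ^ 2 * a) :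
    b ∈ commutator G := by
  have : b = ⁅a, b⁆ := by
    rw [commutatorElement_def, h, mul_inv_cancel_right, pow_two, mul_inv_cancel_right]
  rw [this]
  exact Subgroup.commutator_mem_commutator trivial trivial

theorem eq_one_of_mul_eq {G : Type*} [Group G] {a b : G} (h : a * b = b ^ 2 * a) (ha : a = 1) :
    b = 1 := by
  rw [ha, one_mul, mul_one, pow_two] at h
  exact left_eq_mul.1 h

variable {A : Type} (R : Set (FreeGroup A)) (w : FreeGroup A)

/-- The relators of the Rabin group that do not involve the word. -/
def rabinFixedRels : Set (FreeGroup (RabinGen A)) :=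
  FreeGroup.map base '' R ∪
    Set.range (fun a => sqRel (FreeGroup.of (y a)) (FreeGroup.of (base a))) ∪
    Set.range (fun a => sqRel (FreeGroup.of z) (FreeGroup.of (y a))) ∪
    {sqRel (FreeGroup.of s) (FreeGroup.of z)}

/-- The relator of the Rabin group involving the word. -/
def rabinRel : FreeGroup (RabinGen A) := sqRel (FreeGroup.map base w) (FreeGroup.of s)

/-- The relators of the Rabin group. -/
def rabinRels : Set (FreeGroup (RabinGen A)) := insert (rabinRel w) (rabinFixedRels R)

theorem rabinFixedRels_finite [Finite A] (hR : R.Finite) : (rabinFixedRels R).Finite :=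
  (((hR.image _).union (Set.finite_range _)).union (Set.finite_range _)).union (Set.toFinite _)

theorem lift_rabinRels {M : Type*} [Group M] (f : RabinGen A → M) :
    (∀ x ∈ rabinRels R w, FreeGroup.lift f x = 1) ↔
      FreeGroup.lift (fun a => f (base a)) w * f s =
        f s ^ 2 * FreeGroup.lift (fun a => f (base a)) w ∧
      (∀ x ∈ R, FreeGroup.lift (fun a => f (base a)) x = 1) ∧
      (∀ a, f (y a) * f (base a) = f (base a) ^ 2 * f (y a)) ∧
      (∀ a, f z * f (y a) = f (y a) ^ 2 * f z) ∧ f s * f z = f z ^ 2 * f s := by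
  have : ∀ x, FreeGroup.lift f (FreeGroup.map base x) = FreeGroup.lift (fun a => f (base a)) x :=
    fun x => by rw [FreeGroup.map_eq_lift]; exact DFunLike.congr_fun (f := (FreeGroup.lift f).comp
      (FreeGroup.lift fun a => FreeGroup.of (base a))) (by ext; simp) x
  simp only [rabinRels, rabinFixedRels, rabinRel, Set.mem_union, Set.mem_insert_iff, or_imp,
    forall_and, Set.forall_mem_range, Set.forall_mem_image, Set.mem_singleton_iff, forall_eq,
    map_sqRel, sqRel_eq_one, this, FreeGroup.lift_apply_of, and_assoc]

theorem lift_of_rabinRels :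
    ∀ x ∈ rabinRels R w,
      FreeGroup.lift (PresentedGroup.of : RabinGen A → PresentedGroup (rabinRels R w)) x = 1 := by
  intro x hx
  have : FreeGroup.lift (PresentedGroup.of : RabinGen A → PresentedGroup (rabinRels R w)) =
    PresentedGroup.mk (rabinRels R w) := by ext; simp; rfl
  rw [this]
  exact PresentedGroup.one_of_mem hx

theorem rabin_commutator : commutator (PresentedGroup (rabinRels R w)) = ⊤ := by
  obtain ⟨h1, -, h2, h3, h4⟩ := (lift_rabinRels R w _).1 (lift_of_rabinRels R w)
  rw [eq_top_iff, ← PresentedGroup.closure_range_of, Subgroup.closure_le]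
  rintro _ ⟨g, rfl⟩
  cases g with
  | base a => exact mem_commutator_of_mul_eq (h2 a)
  | y a => exact mem_commutator_of_mul_eq (h3 a)
  | z => exact mem_commutator_of_mul_eq h4
  | s => exact mem_commutator_of_mul_eq h1

theorem rabin_subsingleton (hw : PresentedGroup.mk R w = 1) :
    Subsingleton (PresentedGroup (rabinRels R w)) := by
  obtain ⟨h1, h0, h2, h3, h4⟩ := (lift_rabinRels R w _).1 (lift_of_rabinRels R w)
  have hs := eq_one_of_mul_eq h1 (by
    have e : (PresentedGroup.toGroup h0).comp (PresentedGroup.mk R) = FreeGroup.lift fun a =>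
        (PresentedGroup.of (base a) : PresentedGroup (rabinRels R w)) := by
      apply FreeGroup.ext_hom
      intro a
      rw [FreeGroup.lift_apply_of]
      exact PresentedGroup.toGroup.of h0
    rw [← e, MonoidHom.comp_apply, hw, map_one])
  have hz := eq_one_of_mul_eq h4 hs
  have hy := fun a => eq_one_of_mul_eq (h3 a) hz
  have hb := fun a => eq_one_of_mul_eq (h2 a) (hy a)
  have : (⊤ : Subgroup (PresentedGroup (rabinRels R w))) = ⊥ := by
    rw [eq_bot_iff, ← PresentedGroup.closure_range_of, Subgroup.closure_le]
    rintro _ ⟨g, rfl⟩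
    cases g with
    | base a => exact hb a
    | y a => exact hy a
    | z => exact hz
    | s => exact hs
  exact Subgroup.subsingleton_iff.1 (subsingleton_of_bot_eq_top this.symm)

theorem zpowersHom_ofAdd {G : Type*} [Group G] (g : G) (n : ℤ) :
    zpowersHom G g (Multiplicative.ofAdd n) = g ^ n := rfl

theorem TorsionFree.zpowersHom_injective {G : Type*} [Group G] (hG : TorsionFree G) {g : G}
    (hg : g ≠ 1) : Function.Injective (zpowersHom G g) := by
  rw [injective_iff_map_eq_one]
  intro n hn
  exact hG.zpow_eq_one hg hn

theorem TorsionFree.sq_ne_one {G : Type*} [Group G] (hG : TorsionFree G) {g : G}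
    (hg : g ≠ 1) : g ^ 2 ≠ 1 := fun h => hg (hG g 2 (by norm_num) h)

/-- The quotient of the Baumslag chain: a group generated by `z`, `s` and `w`, with `s` conjugating
`z` to its square and `w` conjugating `s` to its square. -/
theorem exists_chain_group : ∃ (Q : Type) (_ : Group Q) (z s w : Q), TorsionFree Q ∧
    s * z = z ^ 2 * s ∧ w * s = s ^ 2 * w ∧
    Function.Injective (FreeGroup.lift fun b : Bool => if b then z else w) ∧
    Subgroup.closure {z, s, w} = ⊤ ∧
    ∀ {M : Type} [Group M] (z' s' w' : M), s' * z' = z' ^ 2 * s' → w' * s' = s' ^ 2 * w' →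
      ∃ F : Q →* M, F z = z' ∧ F s = s' ∧ F w = w' := by
  let Z := Multiplicative ℤ
  have hZ : TorsionFree Z := fun g n hn h => (pow_eq_one_iff_left hn.ne').1 h
  let g : Z := Multiplicative.ofAdd 1
  have hg : g ≠ 1 := fun h => one_ne_zero (α := ℤ) h
  let α := zpowersHom Z g
  let β := zpowersHom Z (g ^ 2)
  have hα : Function.Injective α := hZ.zpowersHom_injective hg
  have hβ : Function.Injective β := hZ.zpowersHom_injective (hZ.sq_ne_one hg)
  let o := HNN.of α β hα hβ
  let s := HNN.t α β hα hβ
  have ho : Function.Injective o := HNN.of_injective α β hα hβ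
  have hQ₁ : TorsionFree (HNN α β hα hβ) := HNN.torsionFree α β hα hβ hZ
  have hsg : s * o g = o g ^ 2 * s := by
    have := HNN.t_mul α β hα hβ g
    simpa [α, β, g, zpowersHom_ofAdd, o, s] using this
  obtain ⟨ρ, hρ, hρs⟩ := HNN.exists_lift α β hα hβ (1 : Z →* Z) g (by simp)
  have hs : s ≠ 1 := by
    intro h
    apply hg
    rw [← hρs]
    exact (congrArg ρ h).trans (map_one ρ)
  let α' := zpowersHom _ s
  let β' := zpowersHom _ (s ^ 2)
  have hα' : Function.Injective α' := hQ₁.zpowersHom_injective hs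
  have hβ' : Function.Injective β' := hQ₁.zpowersHom_injective (hQ₁.sq_ne_one hs)
  let o' := HNN.of α' β' hα' hβ'
  let w := HNN.t α' β' hα' hβ'
  have hker : ∀ x ∈ Subgroup.zpowers (o g), ρ x = 1 := by
    rintro _ ⟨n, rfl⟩
    simp only [map_zpow]
    rw [hρ]
    simp
  have hws : w * o' s = o' s ^ 2 * w := by
    have := HNN.t_mul α' β' hα' hβ' g
    simpa [α', β', g, zpowersHom_ofAdd, o', w] using this
  have hinj := HNN.injective_freeGroup_lift α' β' hα' hβ' (h := o g)
    (fun n h => hQ₁.zpow_eq_one (fun h => hg (ho (h.trans (map_one o).symm))) h)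
    (fun c hc => by
      have := hker _ hc
      simp only [α', zpowersHom_apply, map_zpow] at this
      rw [hρs] at this
      exact hZ.zpow_eq_one hg this)
    (fun c hc => by
      have := hker _ hc
      simp only [β', zpowersHom_apply, map_zpow, map_pow] at this
      rw [hρs] at this
      exact hZ.zpow_eq_one (hZ.sq_ne_one hg) this)
  refine ⟨HNN α' β' hα' hβ', inferInstance, o' (o g), o' s, w, HNN.torsionFree α' β' hα' hβ' hQ₁,
    ?_, hws, ?_, ?_, ?_⟩
  · simpa using congrArg o' hsg
  · have e : (FreeGroup.lift fun b : Bool => if b then o' (o g) else w) =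
        (FreeGroup.lift fun b : Bool => if b then w else o' (o g)).comp
          (FreeGroup.freeGroupCongr Equiv.boolNot).toMonoidHom := by
      ext b
      cases b <;> simp
    rw [e]
    exact hinj.comp (FreeGroup.freeGroupCongr Equiv.boolNot).injective
  · rw [eq_top_iff, ← HNN.closure_eq_top, Subgroup.closure_le]
    rintro _ (⟨x, rfl⟩ | rfl)
    · have hx : x ∈ Subgroup.closure (Set.range o ∪ {s}) := by
        rw [HNN.closure_eq_top]; trivial
      rw [SetLike.mem_coe, ← Subgroup.mem_comap]
      refine (Subgroup.closure_le _).2 ?_ hx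
      rintro _ (⟨n, rfl⟩ | rfl)
      · have : n = g ^ n.toAdd := by
          rw [← ofAdd_zsmul]; simp
        rw [this, map_zpow]
        refine zpow_mem ?_ _
        exact Subgroup.subset_closure (Or.inl rfl)
      · exact Subgroup.subset_closure (Or.inr (Or.inl rfl))
    · exact Subgroup.subset_closure (Or.inr (Or.inr rfl))
  · intro M _ z' s' w' h h'
    obtain ⟨F, hF, hFs⟩ := HNN.exists_lift α β hα hβ (zpowersHom M z') s' (fun c => by
      have : (MulAut.conj s' z') ^ c.toAdd = (z' ^ 2) ^ c.toAdd := by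
        rw [MulAut.conj_apply, h, mul_inv_cancel_right]
      rw [← map_zpow, MulAut.conj_apply, mul_inv_eq_iff_eq_mul] at this
      have hα' : zpowersHom M z' (α c) = z' ^ c.toAdd := by
        rw [zpowersHom_apply, zpowersHom_apply, ← ofAdd_zsmul]
        simp
      have hβ' : zpowersHom M z' (β c) = (z' ^ 2) ^ c.toAdd := by
        change zpowersHom M z' ((g ^ 2) ^ c.toAdd) = _
        rw [map_zpow (zpowersHom M z'), map_pow (zpowersHom M z')]
        exact congrArg (fun x => (x ^ 2) ^ c.toAdd) (zpow_one z')
      rw [hα', hβ', this])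
    obtain ⟨F', hF', hFw⟩ := HNN.exists_lift α' β' hα' hβ' F w' (fun c => by
      have : (MulAut.conj w' s') ^ c.toAdd = (s' ^ 2) ^ c.toAdd := by
        rw [MulAut.conj_apply, h', mul_inv_cancel_right]
      rw [← map_zpow, MulAut.conj_apply, mul_inv_eq_iff_eq_mul] at this
      simp only [α', β', zpowersHom_apply, map_zpow, map_pow]
      rw [hFs]
      exact this)
    refine ⟨F', ?_, (hF' _).trans hFs, hFw⟩
    refine (hF' _).trans ((hF _).trans ?_)
    exact zpow_one z'

end Rabin

section RabinTorsionFree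

open RabinGen

theorem rabin_torsionFree {A : Type} [Finite A] (R : Set (FreeGroup A)) (w : FreeGroup A)
    (hH : TorsionFree (PresentedGroup R)) (hne : ∀ a, (PresentedGroup.of a : PresentedGroup R) ≠ 1)
    (hw : PresentedGroup.mk R w ≠ 1) :
    TorsionFree (PresentedGroup (rabinRels R w)) ∧
      Nontrivial (PresentedGroup (rabinRels R w)) := by
  obtain ⟨h1, h0, h2, h3, h4⟩ := (lift_rabinRels R w _).1 (lift_of_rabinRels R w)
  let b : PresentedGroup R →* PresentedGroup (rabinRels R w) := PresentedGroup.toGroup h0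
  have hb : ∀ a, b (PresentedGroup.of a) = PresentedGroup.of (base a) := fun a =>
    PresentedGroup.toGroup.of h0
  have hbw : b (PresentedGroup.mk R w) = FreeGroup.lift
      (fun a => (PresentedGroup.of (base a) : PresentedGroup (rabinRels R w))) w := by
    change (b.comp (PresentedGroup.mk R)) w = _
    refine DFunLike.congr_fun (FreeGroup.ext_hom _ _ fun a => ?_) w
    rw [FreeGroup.lift_apply_of]
    exact hb a
  -- the side containing the presented group
  obtain ⟨M⟩ := MultiHNN.nonempty
    (fun a => zpowersHom (PresentedGroup R) (PresentedGroup.of a))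
    (fun a => zpowersHom (PresentedGroup R) (PresentedGroup.of a ^ 2))
    (fun a => hH.zpowersHom_injective (hne a))
    fun a => hH.zpowersHom_injective (hH.sq_ne_one (hne a))
  have hM : ∀ a, M.r a * M.of (PresentedGroup.of a) = M.of (PresentedGroup.of a) ^ 2 * M.r a := by
    intro a
    have := M.rel a (Multiplicative.ofAdd 1)
    simpa [zpowersHom_ofAdd] using this
  let α := FreeGroup.lift M.r
  let β := (FreeGroup.lift M.r).comp (FreeGroup.lift fun a => FreeGroup.of a ^ 2)
  have hα : Function.Injective α := M.injective_lift_r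
  have hβ : Function.Injective β := M.injective_lift_r.comp FreeGroup.lift_sq_injective
  have hMtf := M.torsionFree hH
  have hmem : ∀ c, α c ∈ Subgroup.closure (Set.range M.r) := fun c => by
    rw [← FreeGroup.range_lift_eq_closure]
    exact ⟨c, rfl⟩
  have hα1 : ∀ c, α c ∈ Subgroup.zpowers (M.of (PresentedGroup.mk R w)) → α c = 1 := by
    rintro c ⟨n, hn⟩
    simp only [← map_zpow] at hn
    have h : M.of (PresentedGroup.mk R (w ^ n)) ∈ Subgroup.closure (Set.range M.r) := by
      rw [hn]; exact hmem c
    rw [← hn, M.eq_one_of_mem_closure_r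
      (fun a => hH.zpowersHom_injective (hne a))
      (fun a => hH.zpowersHom_injective (hH.sq_ne_one (hne a))) h, map_one]
  let o := HNN.of α β hα hβ
  let τ := HNN.t α β hα hβ
  have hz : ∀ c, τ * o (α c) = o (β c) * τ := HNN.t_mul α β hα hβ
  have hinj := HNN.injective_freeGroup_lift α β hα hβ (h := M.of (PresentedGroup.mk R w))
    (fun n h => hMtf.zpow_eq_one
      (fun h => hw (M.of_injective (h.trans (map_one M.of).symm))) h)
    (fun c hc => hα ((hα1 c hc).trans (map_one α).symm))
    (fun c hc => hβ ((hα1 _ hc).trans (map_one β).symm))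
  obtain ⟨F₁, hF₁, hF₁y⟩ := M.exists_lift b (fun a => PresentedGroup.of (y a)) (fun a c => by
    have : (MulAut.conj (PresentedGroup.of (y a) : PresentedGroup (rabinRels R w))
        (PresentedGroup.of (base a))) ^ c.toAdd =
        (PresentedGroup.of (base a) ^ 2) ^ c.toAdd := by
      rw [MulAut.conj_apply, h2, mul_inv_cancel_right]
    rw [← map_zpow, MulAut.conj_apply, mul_inv_eq_iff_eq_mul] at this
    rw [zpowersHom_apply, zpowersHom_apply, map_zpow, map_zpow, map_pow, hb]
    exact this)
  obtain ⟨f₁, hf₁, hf₁z⟩ := HNN.exists_lift α β hα hβ F₁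
    (PresentedGroup.of RabinGen.z : PresentedGroup (rabinRels R w)) (fun c => by
      have : ((MulAut.conj (PresentedGroup.of RabinGen.z :
          PresentedGroup (rabinRels R w))).toMonoidHom.comp F₁).comp α = F₁.comp β := by
        apply FreeGroup.ext_hom
        intro a
        simp only [MonoidHom.comp_apply, α, β, FreeGroup.lift_apply_of, map_pow, hF₁y]
        change MulAut.conj _ _ = _
        rw [MulAut.conj_apply, h3, mul_inv_cancel_right]
      have := DFunLike.congr_fun this c
      exact mul_inv_eq_iff_eq_mul.1 this)
  obtain ⟨Q, _, zQ, sQ, wQ, hQ, hsz, hws, hinjQ, hclQ, hQlift⟩ := exists_chain_group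
  obtain ⟨f₂, hf₂z, hf₂s, hf₂w⟩ := hQlift (PresentedGroup.of RabinGen.z)
    (PresentedGroup.of RabinGen.s) (b (PresentedGroup.mk R w)) h4 (by rw [hbw]; exact h1)
  have hf₁b : ∀ a, f₁ (o (M.of (PresentedGroup.of a))) = PresentedGroup.of (base a) := fun a =>
    (hf₁ _).trans ((hF₁ _).trans (hb a))
  have hf₁y : ∀ a, f₁ (o (M.r a)) = PresentedGroup.of (y a) := fun a => (hf₁ _).trans (hF₁y a)
  have key := torsionFree_amalgam _ _ hinj hinjQ (HNN.torsionFree α β hα hβ hMtf) hQ f₁ f₂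
    (fun c => ?_) ?_ ?_
  · refine ⟨key.1, ?_⟩
    refine nontrivial_of_ne (f₁ (o (M.of (PresentedGroup.mk R w)))) 1 fun h => hw ?_
    exact M.of_injective (HNN.of_injective α β hα hβ
      (key.2 (by rw [map_one, map_one, map_one]; exact h)))
  · refine DFunLike.congr_fun (f := f₁.comp _) (g := f₂.comp _) (FreeGroup.ext_hom _ _ ?_) c
    rintro (_ | _)
    · simp only [MonoidHom.comp_apply, FreeGroup.lift_apply_of]
      exact ((hf₁ _).trans (hF₁ _)).trans hf₂w.symm
    · simp only [MonoidHom.comp_apply, FreeGroup.lift_apply_of]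
      exact hf₁z.trans hf₂z.symm
  · rw [eq_top_iff, ← PresentedGroup.closure_range_of, Subgroup.closure_le]
    rintro _ ⟨g, rfl⟩
    apply Subgroup.subset_closure
    cases g with
    | base a => exact Or.inl ⟨_, hf₁b a⟩
    | y a => exact Or.inl ⟨_, hf₁y a⟩
    | z => exact Or.inl ⟨_, hf₁z⟩
    | s => exact Or.inr ⟨_, hf₂s⟩
  · intro N _ g₁ g₂ hg
    let φ : RabinGen A → N := fun
      | .base a => g₁ (o (M.of (PresentedGroup.of a)))
      | .y a => g₁ (o (M.r a))
      | .z => g₁ τ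
      | .s => g₂ sQ
    have hgw : g₁ (o (M.of (PresentedGroup.mk R w))) = g₂ wQ := by
      have := hg (FreeGroup.of false)
      simp only [FreeGroup.lift_apply_of] at this
      exact this
    have hgz : g₁ τ = g₂ zQ := by
      have := hg (FreeGroup.of true)
      simp only [FreeGroup.lift_apply_of] at this
      exact this
    have hφ : FreeGroup.lift (fun a => φ (base a)) =
        ((g₁.comp o).comp M.of).comp (PresentedGroup.mk R) := by
      apply FreeGroup.ext_hom
      intro a
      rw [FreeGroup.lift_apply_of]
      rfl
    have hφr : ∀ x ∈ rabinRels R w, FreeGroup.lift φ x = 1 := by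
      rw [lift_rabinRels, hφ]
      refine ⟨?_, fun x hx => ?_, fun a => ?_, fun a => ?_, ?_⟩
      · change g₁ (o (M.of (PresentedGroup.mk R w))) * g₂ sQ = g₂ sQ ^ 2 *
          g₁ (o (M.of (PresentedGroup.mk R w)))
        rw [hgw, ← map_mul, ← map_pow, ← map_mul, hws]
      · rw [MonoidHom.comp_apply, PresentedGroup.one_of_mem hx, map_one]
      · have := congrArg (fun x => g₁ (o x)) (hM a)
        simp only [map_mul, map_pow] at this
        exact this
      · have := congrArg g₁ (hz (FreeGroup.of a))
        simp only [map_mul, map_pow, α, β, MonoidHom.comp_apply, FreeGroup.lift_apply_of] at this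
        exact this
      · change g₂ sQ * g₁ τ = g₁ τ ^ 2 * g₂ sQ
        rw [hgz, ← map_mul, ← map_pow, ← map_mul, hsz]
    have hF : ∀ g, PresentedGroup.toGroup hφr (PresentedGroup.of g) = φ g := fun g =>
      PresentedGroup.toGroup.of hφr
    have e₁ : ((PresentedGroup.toGroup hφr).comp f₁) = g₁ := by
      apply HNNExtension.hom_ext
      · apply M.hom_ext
        · intro k
          change (((((PresentedGroup.toGroup hφr).comp f₁).comp o).comp M.of)) k =
            ((g₁.comp o).comp M.of) k
          congr 1
          apply PresentedGroup.ext
          intro a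
          exact (congrArg _ (hf₁b a)).trans (hF _)
        · intro a
          exact (congrArg _ (hf₁y a)).trans (hF _)
      · exact (congrArg _ hf₁z).trans (hF _)
    have e₂ : ((PresentedGroup.toGroup hφr).comp f₂) = g₂ := by
      apply MonoidHom.eq_of_eqOn_dense hclQ
      rintro _ (rfl | rfl | rfl)
      · exact ((congrArg _ hf₂z).trans (hF _)).trans hgz
      · exact (congrArg _ hf₂s).trans (hF _)
      · refine (congrArg _ hf₂w).trans ?_
        rw [← hgw]
        refine (congrArg (PresentedGroup.toGroup hφr) ?_).trans
          (DFunLike.congr_fun e₁ (o (M.of (PresentedGroup.mk R w))))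
        exact ((hf₁ _).trans (hF₁ _)).symm
    exact ⟨PresentedGroup.toGroup hφr, DFunLike.congr_fun e₁, DFunLike.congr_fun e₂⟩

end RabinTorsionFree

section Simulation

open Turing

/-- Two points are related if a rule leads from the first to the second. -/
def RuleStep {ι : Type} (ρ : ι → Rule) (v w : ℤ × ℤ) : Prop :=
  ∃ i u, v = (ρ i).m * u + (ρ i).a ∧ w = (ρ i).m' * u + (ρ i).a'

theorem RuleStep.closed {ι : Type} {ρ : ι → Rule} {v₀ : ℤ × ℤ}
    (hρ : ∀ v w w', RuleStep ρ v w → RuleStep ρ v w' → w = w') (hv₀ : RuleStep ρ v₀ v₀) (i : ι) :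
    (ρ i).Closed {v | Relation.ReflTransGen (RuleStep ρ) v v₀} := by
  intro u
  have hi : RuleStep ρ ((ρ i).m * u + (ρ i).a) ((ρ i).m' * u + (ρ i).a') := ⟨i, u, rfl, rfl⟩
  refine ⟨fun h => ?_, fun h => Relation.ReflTransGen.head hi h⟩
  rcases Relation.ReflTransGen.cases_head h with h | ⟨w, hw, h⟩
  · rw [h] at hi
    exact hρ _ _ _ hv₀ hi ▸ .refl
  · exact hρ _ _ _ hw hi ▸ h

theorem RuleStep.subset_of_closed {ι : Type} {ρ : ι → Rule} {v₀ : ℤ × ℤ} {S : Set (ℤ × ℤ)}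
    (hv₀ : v₀ ∈ S) (hS : ∀ i, (ρ i).Closed S) :
    {v | Relation.ReflTransGen (RuleStep ρ) v v₀} ⊆ S := by
  intro v hv
  induction hv using Relation.ReflTransGen.head_induction_on with
  | refl => exact hv₀
  | head h _ ih =>
    obtain ⟨i, u, rfl, rfl⟩ := h
    exact (hS i u).2 ih

/-- The number whose digits in base `b` are given by the list, the first one being the lowest. -/
def digitSum {Γ : Type*} (b : ℕ) (d : Γ → ℕ) (l : List Γ) : ℕ := l.foldr (fun a n => d a + b * n) 0

theorem digitSum_append_replicate {Γ : Type*} {b : ℕ} {d : Γ → ℕ} {a : Γ} (ha : d a = 0)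
    (l : List Γ) (n : ℕ) : digitSum b d (l ++ List.replicate n a) = digitSum b d l := by
  have : digitSum b d (List.replicate n a) = 0 := by
    induction n with
    | zero => rfl
    | succ n ih =>
      change d a + b * digitSum b d (List.replicate n a) = 0
      rw [ih, ha, mul_zero, add_zero]
  induction l with
  | nil => exact this
  | cons x l ih => exact congrArg (fun n => d x + b * n) ih

/-- The value of a half-tape as a number in base `b`. -/
def Turing.ListBlank.value {Γ : Type*} [Inhabited Γ] (b : ℕ) (d : Γ → ℕ) (hd : d default = 0)
    (L : ListBlank Γ) : ℕ :=
  L.liftOn (digitSum b d) fun _ _ ⟨n, h⟩ => by rw [h, digitSum_append_replicate hd]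

section value
variable {Γ : Type*} [Inhabited Γ] {b : ℕ} {d : Γ → ℕ} {hd : d default = 0}

theorem Turing.ListBlank.value_mk (l : List Γ) :
    (ListBlank.mk l).value b d hd = digitSum b d l := rfl

theorem Turing.ListBlank.value_cons (a : Γ) (L : ListBlank Γ) :
    (L.cons a).value b d hd = d a + b * L.value b d hd := by
  induction L using ListBlank.induction_on with
  | h l => rfl

theorem Turing.ListBlank.value_eq (L : ListBlank Γ) :
    L.value b d hd = d L.head + b * L.tail.value b d hd := by
  rw [← value_cons, cons_head_tail]

end value

theorem Fin.eq_of_mul_add_eq {n : ℕ} {i j : Fin n} {x y : ℤ}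
    (h : (n : ℤ) * x + (i : ℕ) = n * y + (j : ℕ)) : i = j ∧ x = y := by
  have hn : (0 : ℤ) < n := by exact_mod_cast i.pos
  have hi : ((i : ℕ) : ℤ) < n := by exact_mod_cast i.2
  have hj : ((j : ℕ) : ℤ) < n := by exact_mod_cast j.2
  have e : ((i : ℕ) : ℤ) = (j : ℕ) := by
    have := congrArg (· % (n : ℤ)) h
    simpa [Int.emod_eq_of_lt, hi, hj] using this
  refine ⟨Fin.ext (by exact_mod_cast e), ?_⟩
  rw [e] at h
  exact mul_left_cancel₀ hn.ne' (add_right_cancel h)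

variable {Γ Λ : Type} [Inhabited Λ] {N b : ℕ}

/-- The target of the rule simulating a machine in a given state, reading the symbol `g` with
the symbol `h` to the left of the head. The missing state erases the tape. -/
def simTarget (M : TM0.Machine Γ Λ) (e : Option Λ ≃ Fin N) (d : Γ ≃ Fin b) (q : Option Λ)
    (g h : Γ) : (ℕ × ℕ) × (ℕ × ℕ) :=
  match q.bind (M · g) with
  | none => ((N, 1), (e none, 0))
  | some (q', .write g') => ((N * b, b), (N * d g' + e q', d h))
  | some (q', .move .right) => ((N, b * b), (e q', b * d h + d g))
  | some (q', .move .left) => ((N * (b * b), 1), (N * (d h + b * d g) + e q', 0))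

theorem simTarget_pos (hN : 0 < N) (hb : 0 < b) (M : TM0.Machine Γ Λ) (e : Option Λ ≃ Fin N)
    (d : Γ ≃ Fin b) (q : Option Λ) (g h : Γ) :
    0 < (simTarget M e d q g h).1.1 ∧ 0 < (simTarget M e d q g h).1.2 := by
  unfold simTarget
  split <;> simp [hN, hb]

/-- The rules simulating a machine. -/
def simRule (hN : 0 < N) (hb : 0 < b) (M : TM0.Machine Γ Λ) (e : Option Λ ≃ Fin N)
    (d : Γ ≃ Fin b) (i : Option Λ × Γ × Γ) : Rule where
  m := ((N * b : ℕ), (b : ℕ))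
  a := ((N * d i.2.1 + e i.1 : ℕ), (d i.2.2 : ℕ))
  m' := ((simTarget M e d i.1 i.2.1 i.2.2).1.1, (simTarget M e d i.1 i.2.1 i.2.2).1.2)
  a' := ((simTarget M e d i.1 i.2.1 i.2.2).2.1, (simTarget M e d i.1 i.2.1 i.2.2).2.2)
  injective_m := by
    intro x y h
    have := Prod.mk.inj h
    exact Prod.ext (mul_left_cancel₀ (by positivity) this.1)
      (mul_left_cancel₀ (by positivity) this.2)
  injective_m' := by
    intro x y h
    have := Prod.mk.inj h
    obtain ⟨h1, h2⟩ := simTarget_pos hN hb M e d i.1 i.2.1 i.2.2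
    exact Prod.ext (mul_left_cancel₀ (Nat.cast_ne_zero.2 h1.ne') this.1)
      (mul_left_cancel₀ (Nat.cast_ne_zero.2 h2.ne') this.2)

section
variable (hN : 0 < N) (hb : 0 < b) (M : TM0.Machine Γ Λ) (e : Option Λ ≃ Fin N) (d : Γ ≃ Fin b)

theorem simRule_deterministic {v w w' : ℤ × ℤ} (h : RuleStep (simRule hN hb M e d) v w)
    (h' : RuleStep (simRule hN hb M e d) v w') : w = w' := by
  obtain ⟨⟨q, g, k⟩, u, rfl, rfl⟩ := h
  obtain ⟨⟨q', g', k'⟩, u', hv, rfl⟩ := h'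
  simp only [simRule, Prod.ext_iff, Prod.fst_add, Prod.fst_mul, Prod.snd_add, Prod.snd_mul] at hv
  push_cast at hv
  obtain ⟨h1, h2⟩ := Fin.eq_of_mul_add_eq (i := e q) (j := e q') (x := b * u.1 + (d g : ℕ))
    (y := b * u'.1 + (d g' : ℕ)) (by linarith [hv.1])
  obtain ⟨h3, h4⟩ := Fin.eq_of_mul_add_eq h2
  obtain ⟨h5, h6⟩ := Fin.eq_of_mul_add_eq hv.2
  obtain rfl := e.injective h1
  obtain rfl := d.injective h3
  obtain rfl := d.injective h5
  obtain rfl : u = u' := Prod.ext h4 h6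
  rfl

theorem simRule_step (q : Option Λ) (g h : Γ) (x y : ℕ) :
    RuleStep (simRule hN hb M e d)
      (((N * (d g + b * x) + e q : ℕ) : ℤ), ((d h + b * y : ℕ) : ℤ))
      ((((simTarget M e d q g h).1.1 * x + (simTarget M e d q g h).2.1 : ℕ) : ℤ),
        (((simTarget M e d q g h).1.2 * y + (simTarget M e d q g h).2.2 : ℕ) : ℤ)) := by
  refine ⟨(q, g, h), ((x : ℤ), (y : ℤ)), ?_, ?_⟩
  · simp only [simRule, Prod.ext_iff, Prod.fst_add, Prod.fst_mul, Prod.snd_add, Prod.snd_mul]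
    push_cast
    constructor <;> ring
  · simp only [simRule, Prod.ext_iff, Prod.fst_add, Prod.fst_mul, Prod.snd_add, Prod.snd_mul]
    push_cast
    constructor <;> ring

theorem simRule_erase (q : Option Λ) (x y : ℕ)
    (hq : q.bind (M · (d.symm ⟨x % b, x.mod_lt hb⟩)) = none) :
    RuleStep (simRule hN hb M e d) (((N * x + e q : ℕ) : ℤ), (y : ℤ))
      (((N * (x / b) + e none : ℕ) : ℤ), ((y / b : ℕ) : ℤ)) := by
  have := simRule_step hN hb M e d q (d.symm ⟨x % b, x.mod_lt hb⟩) (d.symm ⟨y % b, y.mod_lt hb⟩)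
    (x / b) (y / b)
  simp only [Equiv.apply_symm_apply, Nat.mod_add_div, simTarget, hq, one_mul, add_zero] at this
  exact this

theorem simRule_erase_reaches (hb2 : 1 < b) (n x y : ℕ) (hx : x < n) (hy : y < n) :
    Relation.ReflTransGen (RuleStep (simRule hN hb M e d)) (((N * x + e none : ℕ) : ℤ), (y : ℤ))
      (((e none : ℕ) : ℤ), 0) := by
  induction n generalizing x y with
  | zero => omega
  | succ n ih =>
    rcases Nat.eq_zero_or_pos n with rfl | hn
    · obtain rfl : x = 0 := by omega
      obtain rfl : y = 0 := by omega
      rw [mul_zero, zero_add]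
      exact .refl
    · refine .head (simRule_erase hN hb M e d none x y rfl) (ih _ _ ?_ ?_)
      · exact lt_of_le_of_lt (Nat.div_le_div_right (Nat.lt_succ_iff.1 hx)) (Nat.div_lt_self hn hb2)
      · exact lt_of_le_of_lt (Nat.div_le_div_right (Nat.lt_succ_iff.1 hy)) (Nat.div_lt_self hn hb2)

variable [Inhabited Γ]

/-- The point coding a configuration. -/
def simCode (hd' : (d default : ℕ) = 0) (c : TM0.Cfg Γ Λ) : ℤ × ℤ :=
  (((N * c.Tape.right₀.value b (fun g => d g) hd' + e c.q : ℕ) : ℤ),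
    ((c.Tape.left.value b (fun g => d g) hd' : ℕ) : ℤ))

variable (hd' : (d default : ℕ) = 0)

theorem simCode_step {c c' : TM0.Cfg Γ Λ} (h : c' ∈ TM0.step M c) :
    RuleStep (simRule hN hb M e d) (simCode e d hd' c) (simCode e d hd' c') := by
  obtain ⟨q, T⟩ := c
  obtain ⟨L, R, rfl⟩ := T.exists_mk'
  obtain ⟨⟨q', s⟩, hs, rfl⟩ := Option.map_eq_some_iff.1 h
  have := simRule_step hN hb M e d q R.head L.head (R.tail.value b (fun g => d g) hd')
    (L.tail.value b (fun g => d g) hd')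
  rw [← ListBlank.value_eq (d := fun g => (d g : ℕ)),
    ← ListBlank.value_eq (d := fun g => (d g : ℕ))] at this
  rw [Tape.mk'_head] at hs
  simp only [simTarget, Option.bind_some, hs] at this
  simp only [simCode, Tape.mk'_right₀, Tape.mk'_left]
  convert this using 1
  rcases s with (_ | _) | g'
  · simp only [Tape.move_left_mk', Tape.mk'_right₀, Tape.mk'_left, ListBlank.value_cons]
    rw [ListBlank.value_eq (d := fun g => (d g : ℕ)) R]
    congr 2 <;> ring
  · simp only [Tape.move_right_mk', Tape.mk'_right₀, Tape.mk'_left, ListBlank.value_cons]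
    rw [ListBlank.value_eq (d := fun g => (d g : ℕ)) L]
    congr 2
    ring
  · simp only [Tape.write_mk', Tape.mk'_right₀, Tape.mk'_left, ListBlank.value_cons]
    rw [ListBlank.value_eq (d := fun g => (d g : ℕ)) L]
    congr 2 <;> ring

theorem simCode_reaches_iff (hb2 : 1 < b) (c : TM0.Cfg Γ Λ) :
    Relation.ReflTransGen (RuleStep (simRule hN hb M e d)) (simCode e d hd' c)
      (((e none : ℕ) : ℤ), 0) ↔ (StateTransition.eval (TM0.step M) c).Dom := by
  constructor
  · intro h
    generalize hv : simCode e d hd' c = v at h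
    induction h using Relation.ReflTransGen.head_induction_on generalizing c with
    | refl =>
      have := (Prod.mk.inj hv).1
      have : e c.q = e none := (Fin.eq_of_mul_add_eq (y := 0)
        (x := c.Tape.right₀.value b (fun g => d g) hd') (by push_cast at this; simpa using this)).1
      simp at this
    | head h _ ih =>
      subst hv
      rcases hc : TM0.step M c with _ | c'
      · exact Part.dom_iff_mem.2 ⟨c, StateTransition.mem_eval.2 ⟨.refl, hc⟩⟩
      · rw [StateTransition.reaches_eval (.single hc)]
        exact ih c' (simRule_deterministic hN hb M e d (simCode_step hN hb M e d hd' hc) h)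
  · intro h
    obtain ⟨c', hc'⟩ := Part.dom_iff_mem.1 h
    obtain ⟨hcc', hc'⟩ := StateTransition.mem_eval.1 hc'
    refine (Relation.ReflTransGen.lift (simCode e d hd')
      (fun _ _ h => simCode_step hN hb M e d hd' h) _ _ hcc').trans ?_
    refine .head (simRule_erase hN hb M e d c'.q _ _ ?_) (simRule_erase_reaches hN hb M e d hb2
      _ _ _ (Nat.lt_succ_of_le (le_max_left _ _)) (Nat.lt_succ_of_le (le_max_right _ _)))
    have hh : d.symm ⟨c'.Tape.right₀.value b (fun g => d g) hd' % b, Nat.mod_lt _ hb⟩ =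
        c'.Tape.head := by
      rw [Equiv.symm_apply_eq]
      apply Fin.ext
      change _ % b = _
      rw [Tape.right₀, ListBlank.value_cons, Nat.add_mul_mod_self_left,
        Nat.mod_eq_of_lt (d c'.Tape.head).2]
    rw [hh]
    exact Option.map_eq_none_iff.1 hc'

end

/-- The halting problem of a machine with finitely many states is a question about reaching a point
by affine rules. -/
theorem Turing.TM0.exists_rules [Inhabited Γ] [Finite Γ] [Nontrivial Γ] [Finite Λ]
    (M : TM0.Machine Γ Λ) :
    ∃ (ι : Type) (_ : Finite ι) (ρ : ι → Rule) (v₀ : ℤ × ℤ) (S : Set (ℤ × ℤ)), v₀ ∈ S ∧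
      (∀ i, (ρ i).Closed S) ∧ (∀ S', v₀ ∈ S' → (∀ i, (ρ i).Closed S') → S ⊆ S') ∧
      ∃ (b N k : ℕ) (d : Γ → ℕ), ∀ l : List Γ,
        (((N * digitSum b d l + k : ℕ) : ℤ), (0 : ℤ)) ∈ S ↔ (TM0.eval M l).Dom := by
  obtain ⟨N, ⟨e⟩⟩ := Finite.exists_equiv_fin (Option Λ)
  obtain ⟨b, ⟨d₀⟩⟩ := Finite.exists_equiv_fin Γ
  have hN : 0 < N := (e none).pos
  have hb2 : 1 < b := by
    have := Finite.one_lt_card (α := Γ)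
    rwa [Nat.card_congr d₀, Nat.card_fin] at this
  have hb : 0 < b := by omega
  let d : Γ ≃ Fin b := d₀.trans (Equiv.swap (d₀ default) ⟨0, hb⟩)
  have hd : (d default : ℕ) = 0 := by simp [d]
  refine ⟨_, inferInstance, simRule hN hb M e d, (((e none : ℕ) : ℤ), 0), _, .refl,
    RuleStep.closed (fun _ _ _ => simRule_deterministic hN hb M e d) ?_,
    fun S' h₀ hS' => RuleStep.subset_of_closed h₀ hS', b, N, e (some default), fun g => d g,
    fun l => ?_⟩
  · simpa using simRule_erase hN hb M e d none 0 0 rfl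
  · refine Iff.trans ?_ (simCode_reaches_iff hN hb M e d hd hb2 (TM0.init l))
    have : simCode e d hd (TM0.init l) = (((N * digitSum b (fun g => (d g : ℕ)) l +
        e (some default) : ℕ) : ℤ), (0 : ℤ)) := by
      simp only [simCode, TM0.init, Tape.mk₁, Tape.mk₂, Tape.mk'_right₀, Tape.mk'_left,
        ListBlank.value_mk]
      rfl
    rw [this]
    rfl

end Simulation

section Machine

open Turing

theorem exists_finite_machine {Γ Λ : Type} [Inhabited Γ] [Inhabited Λ] (M : TM0.Machine Γ Λ)
    {S : Set Λ} (hS : S.Finite) (hM : TM0.Supports M S) :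
    ∃ (Λ' : Type) (_ : Inhabited Λ') (_ : Finite Λ') (M' : TM0.Machine Γ Λ'),
      ∀ l, (TM0.eval M' l).Dom ↔ (TM0.eval M l).Dom := by
  classical
  let : Inhabited S := ⟨⟨default, hM.1⟩⟩
  let g₁ : PointedMap Λ S :=
    ⟨fun q => if h : q ∈ S then ⟨q, h⟩ else default, by
      rw [dif_pos hM.1]; rfl⟩
  have hg : ∀ q ∈ S, ((g₁ q : S) : Λ) = q := fun q hq => by
    change ((dite _ _ _ : S) : Λ) = q
    rw [dif_pos hq]
  let f : PointedMap Γ Γ := ⟨id, rfl⟩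
  refine ⟨S, inferInstance, hS.to_subtype, M.map f f g₁ Subtype.val, fun l => ?_⟩
  refine StateTransition.tr_eval_dom
    (TM0.Machine.map_respects M f f g₁ Subtype.val hM (fun _ => rfl) hg) ⟨hM.1, ?_⟩
  rw [TM0.map_init]
  congr 1
  exact List.map_id l

instance : Finite PartrecToTM2.K' :=
  Finite.of_surjective ![.main, .rev, .aux, .stack] fun
    | .main => ⟨0, rfl⟩
    | .rev => ⟨1, rfl⟩
    | .aux => ⟨2, rfl⟩
    | .stack => ⟨3, rfl⟩

/-- The tape alphabet of machines computing partial recursive functions. -/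
abbrev TapeSymbol : Type := TM2to1.Γ' PartrecToTM2.K' fun _ => PartrecToTM2.Γ'

instance : Finite TapeSymbol :=
  inferInstanceAs (Finite (Bool × (PartrecToTM2.K' → Option PartrecToTM2.Γ')))

instance : Nontrivial TapeSymbol :=
  inferInstanceAs (Nontrivial (Bool × (PartrecToTM2.K' → Option PartrecToTM2.Γ')))

theorem exists_machine {f : ℕ →. ℕ} (hf : Partrec f) :
    ∃ (Λ : Type) (_ : Inhabited Λ) (_ : Finite Λ) (M : TM0.Machine TapeSymbol Λ), ∀ n,
      (TM0.eval M (TM2to1.trInit .main (PartrecToTM2.trList [n]))).Dom ↔ (f n).Dom := by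
  classical
  obtain ⟨c, hc⟩ := ToPartrec.Code.exists_code (Nat.Partrec'.part_iff₁.2 hf)
  let : Inhabited PartrecToTM2.Λ' := ⟨PartrecToTM2.trNormal c .halt⟩
  have h2 : TM2.Supports PartrecToTM2.tr (PartrecToTM2.codeSupp c .halt) :=
    PartrecToTM2.tr_supports c .halt
  have h1 := TM2to1.tr_supports _ h2
  have h0 := TM1to0.tr_supports _ h1
  obtain ⟨Λ, i, j, M, hM⟩ := exists_finite_machine _ (Finset.finite_toSet _) h0
  refine ⟨Λ, i, j, M, fun n => ?_⟩
  rw [hM, TM1to0.tr_eval]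
  refine (TM2to1.tr_eval_dom (M := PartrecToTM2.tr) _ _).trans ?_
  have : (TM2.init .main (PartrecToTM2.trList [n]) : PartrecToTM2.Cfg') =
      PartrecToTM2.init c [n] := by
    rw [TM2.init, PartrecToTM2.init]
    congr 1
    funext k
    cases k <;> rfl
  change (StateTransition.eval (TM2.step PartrecToTM2.tr)
    (TM2.init .main (PartrecToTM2.trList [n]) : PartrecToTM2.Cfg')).Dom ↔ _
  rw [this, PartrecToTM2.tr_eval, hc ⟨[n], rfl⟩]
  rfl

open PartrecToTM2

theorem trNat_eq_cons {n : ℕ} (hn : n ≠ 0) :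
    trNat n = (if n % 2 = 0 then Γ'.bit0 else Γ'.bit1) :: trNat (n / 2) := by
  have hp : ∀ p : PosNum, trNat p = trPosNum p := fun p => by
    rw [trNat, PosNum.of_to_nat]
    rfl
  rcases h : (n : Num) with _ | p
  · exact absurd (Num.of_nat_inj.1 (by rw [h]; rfl)) hn
  · have hn : n = p := by
      rw [← Num.to_of_nat n, h]; rfl
    rw [hn, hp]
    rcases p with _ | p | p
    · simp [trPosNum]
    · have h2 : ((PosNum.bit1 p : PosNum) : ℕ) = 2 * p + 1 := by
        rw [PosNum.cast_bit1]; ring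
      rw [h2, if_neg (by omega), show (2 * (p : ℕ) + 1) / 2 = p by omega, hp, trPosNum]
    · have h2 : ((PosNum.bit0 p : PosNum) : ℕ) = 2 * p := by
        rw [PosNum.cast_bit0]; ring
      rw [h2, if_pos (by omega), show (2 * (p : ℕ)) / 2 = p by omega, hp, trPosNum]

/-- One step of reading off the binary digits of the first component, accumulating them as digits
in base `b`. -/
def bitStep (b d₀ d₁ : ℕ) (x : ℕ × ℕ) : ℕ × ℕ :=
  if x.1 = 0 then x else (x.1 / 2, (if x.1 % 2 = 0 then d₀ else d₁) + b * x.2)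

theorem bitStep_iterate (b : ℕ) (δ : Γ' → ℕ) (k n a : ℕ) (h : n ≤ k) :
    (bitStep b (δ .bit0) (δ .bit1))^[k] (n, a) =
      (0, (trNat n).foldl (fun x c => δ c + b * x) a) := by
  induction k generalizing n a with
  | zero => obtain rfl : n = 0 := by omega
            simp
  | succ k ih =>
    rw [Function.iterate_succ_apply, bitStep]
    rcases eq_or_ne n 0 with rfl | hn
    · rw [if_pos rfl, ih _ _ (Nat.zero_le _)]
    · rw [if_neg hn, ih _ _ (by change n / 2 ≤ k; omega), trNat_eq_cons hn, List.foldl_cons]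
      split_ifs <;> rfl

theorem primrec_bitStep (b d₀ d₁ : ℕ) : Primrec (bitStep b d₀ d₁) := by
  refine Primrec.ite (Primrec.eq.comp Primrec.fst (Primrec.const 0)) Primrec.id
    (Primrec.pair (Primrec.nat_div.comp Primrec.fst (Primrec.const 2))
      (Primrec.nat_add.comp (Primrec.ite (Primrec.eq.comp (Primrec.nat_mod.comp Primrec.fst
        (Primrec.const 2)) (Primrec.const 0)) (Primrec.const _) (Primrec.const _))
        (Primrec.nat_mul.comp (Primrec.const b) Primrec.snd)))

theorem digitSum_map_reverse {α β : Type*} (b : ℕ) (d : β → ℕ) (e : α → β) (l : List α) :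
    digitSum b d (l.reverse.map e) = l.foldl (fun x c => d (e c) + b * x) 0 := by
  rw [digitSum, List.foldr_map, List.foldr_reverse]

theorem primrec_digitSum_trInit (b : ℕ) (d : TapeSymbol → ℕ) :
    Primrec fun n => digitSum b d (TM2to1.trInit .main (trList [n])) := by
  let e : Γ' → TapeSymbol := fun a => (false, Function.update (fun _ => none) .main (some a))
  let c : TapeSymbol := (true, Function.update (fun _ => none) .main (some .cons))
  have key : ∀ n, digitSum b d (TM2to1.trInit .main (trList [n])) =
      d c + b * ((bitStep b (d (e .bit0)) (d (e .bit1)))^[n] (n, 0)).2 := by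
    intro n
    have : TM2to1.trInit .main (trList [n]) = c :: (trNat n).reverse.map e := by
      rw [TM2to1.trInit, trList, trList, List.reverse_append]
      rfl
    rw [this, bitStep_iterate b (fun a => d (e a)) n n 0 le_rfl]
    exact congrArg (fun x => d c + b * x) (digitSum_map_reverse b d e (trNat n))
  refine Primrec.of_eq ?_ fun n => (key n).symm
  exact Primrec.nat_add.comp (Primrec.const _) (Primrec.nat_mul.comp (Primrec.const _)
    (Primrec.snd.comp (Primrec.nat_iterate Primrec.id (Primrec.pair Primrec.id (Primrec.const 0))
      ((primrec_bitStep b _ _).comp Primrec.snd).to₂)))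

/-- The domain of a partial recursive function is decided by reaching a point by affine rules. -/
theorem exists_rules_of_partrec {f : ℕ →. ℕ} (hf : Partrec f) :
    ∃ (ι : Type) (_ : Finite ι) (ρ : ι → Rule) (v₀ : ℤ × ℤ) (S : Set (ℤ × ℤ)), v₀ ∈ S ∧
      (∀ i, (ρ i).Closed S) ∧ (∀ S', v₀ ∈ S' → (∀ i, (ρ i).Closed S') → S ⊆ S') ∧
      ∃ X : ℕ → ℕ, Computable X ∧ ∀ n, ((X n : ℤ), (0 : ℤ)) ∈ S ↔ (f n).Dom := by
  obtain ⟨Λ, _, _, M, hM⟩ := exists_machine hf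
  obtain ⟨ι, hι, ρ, v₀, S, h₀, hS, hmin, b, N, k, d, hd⟩ := TM0.exists_rules M
  refine ⟨ι, hι, ρ, v₀, S, h₀, hS, hmin, _, ?_, fun n => (hd _).trans (hM n)⟩
  exact (Primrec.nat_add.comp (Primrec.nat_mul.comp (Primrec.const _)
    (primrec_digitSum_trInit b d)) (Primrec.const _)).to_comp

end Machine

section Words

open scoped commutatorElement

variable {k : ℕ}

/-- A sequence of elements of a free group represented by a computable sequence of words. -/
def ComputableWords (g : ℕ → FreeGroup (Fin k)) : Prop :=
  ∃ w : ℕ → Word k, Computable w ∧ ∀ n, FreeGroup.mk (w n) = g n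

theorem ComputableWords.const (x : FreeGroup (Fin k)) : ComputableWords fun _ => x :=
  ⟨fun _ => x.toWord, .const _, fun _ => FreeGroup.mk_toWord⟩

theorem ComputableWords.mul {g h : ℕ → FreeGroup (Fin k)} (hg : ComputableWords g)
    (hh : ComputableWords h) : ComputableWords fun n => g n * h n := by
  obtain ⟨u, hu, hu'⟩ := hg
  obtain ⟨v, hv, hv'⟩ := hh
  exact ⟨fun n => u n ++ v n, Computable.list_append.comp hu hv, fun n => by
    rw [← FreeGroup.mul_mk, hu', hv']⟩

theorem ComputableWords.inv {g : ℕ → FreeGroup (Fin k)} (hg : ComputableWords g) :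
    ComputableWords fun n => (g n)⁻¹ := by
  obtain ⟨u, hu, hu'⟩ := hg
  have h : Primrec (FreeGroup.invRev : Word k → Word k) :=
    Primrec.list_reverse.comp (Primrec.list_map .id
      (Primrec.pair (Primrec.fst.comp .snd) (Primrec.not.comp (Primrec.snd.comp .snd))).to₂)
  exact ⟨fun n => FreeGroup.invRev (u n), h.to_comp.comp hu, fun n => by
    rw [← FreeGroup.inv_mk, hu']⟩

theorem ComputableWords.of_zpow (i : Fin k) {X : ℕ → ℕ} (hX : Computable X) :
    ComputableWords fun n => FreeGroup.of i ^ (X n : ℤ) := by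
  have h : Primrec fun m => (List.range m).map fun _ => (i, true) :=
    Primrec.list_map .list_range (Primrec.const _).to₂
  refine ⟨fun n => (List.range (X n)).map fun _ => (i, true), h.to_comp.comp hX, fun n => ?_⟩
  simp only [zpow_natCast, List.map_const', List.length_range]
  induction X n with
  | zero => rfl
  | succ m ih => rw [List.replicate_succ', ← FreeGroup.mul_mk, ih, pow_succ]; rfl

theorem ComputableWords.commutatorElement {g h : ℕ → FreeGroup (Fin k)} (hg : ComputableWords g)
    (hh : ComputableWords h) : ComputableWords fun n => ⁅g n, h n⁆ :=
  ((hg.mul hh).mul hg.inv).mul hh.inv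

theorem exists_finPres {α : Type} [Finite α] (R : Set (FreeGroup α)) (hR : R.Finite) :
    ∃ (k : ℕ) (e : α ≃ Fin k) (L : List (Word k)), ∀ (x : FreeGroup α) (w : Word k),
      FreeGroup.mk w = FreeGroup.freeGroupCongr e x →
        Nonempty (PresentedGroup (insert x R) ≃* FinPres.Grp ⟨k, w :: L⟩) := by
  classical
  obtain ⟨k, ⟨e⟩⟩ := Finite.exists_equiv_fin α
  refine ⟨k, e, hR.toFinset.toList.map fun x => (FreeGroup.freeGroupCongr e x).toWord,
    fun x w hw => ?_⟩
  have h : {y | ∃ r ∈ w :: hR.toFinset.toList.map fun x => (FreeGroup.freeGroupCongr e x).toWord,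
      y = FreeGroup.mk r} = FreeGroup.freeGroupCongr e '' insert x R := by
    ext y
    simp [Set.image_insert_eq, hw, eq_comm, FreeGroup.mk_toWord]
  change Nonempty (_ ≃* PresentedGroup {y : FreeGroup (Fin k) | _})
  rw [h]
  exact ⟨PresentedGroup.equivPresentedGroup _ e⟩

theorem computableWords_rabinRel_pointWord {ι : Type} (e : RabinGen (PointGen ι) ≃ Fin k)
    {X : ℕ → ℕ} (hX : Computable X) :
    ComputableWords fun n => FreeGroup.freeGroupCongr e (rabinRel (pointWord ι (X n, 0))) := by
  let f : FreeGroup (PointGen ι) →* FreeGroup (Fin k) :=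
    (FreeGroup.freeGroupCongr e).toMonoidHom.comp (FreeGroup.map RabinGen.base)
  have hw : ComputableWords fun n => f (pointWord ι (X n, 0)) := by
    simp only [pointWord, map_commutatorElement, map_conjPoint]
    simp only [conjPoint, monomial, zpow_zero, mul_one]
    have h := ComputableWords.of_zpow (e (.base .X)) hX
    exact (ComputableWords.const _).commutatorElement ((h.mul (.const _)).mul h.inv)
  have h : ∀ n, FreeGroup.freeGroupCongr e (rabinRel (pointWord ι (X n, 0))) =
      sqRel (f (pointWord ι (X n, 0))) (FreeGroup.of (e .s)) := fun n =>
    map_sqRel (FreeGroup.freeGroupCongr e).toMonoidHom _ _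
  simp only [h, sqRel]
  exact ((hw.mul (.const _)).mul hw.inv).mul (.const _)

theorem computable_encode_finPres {w : ℕ → Word k} (hw : Computable w) (L : List (Word k)) :
    Computable fun n => Encodable.encode (⟨k, w n :: L⟩ : FinPres) := by
  have h : Computable fun n => Nat.pair k (Encodable.encode (w n :: L)) :=
    Primrec₂.natPair.to_comp.comp (.const k)
      (Computable.encode.comp (Computable.list_cons.comp hw (.const L)))
  exact h

end Words

theorem FinPres.exists_of_partrec {f : ℕ →. ℕ} (hf : Partrec f) :
    ∃ P : ℕ → FinPres, (Computable fun n => Encodable.encode (P n)) ∧ ∀ n,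
      commutator (P n).Grp = ⊤ ∧ TorsionFree (P n).Grp ∧ (Subsingleton (P n).Grp ↔ (f n).Dom) := by
  obtain ⟨ι, _, ρ, v₀, S, hv₀, hS, hS', X, hX, hXS⟩ := exists_rules_of_partrec hf
  obtain ⟨hH, hne, hmem⟩ := exists_pointGroup_model ρ v₀ hS hv₀
  obtain ⟨k, e, L, hL⟩ := exists_finPres _ (rabinFixedRels_finite _ (pointRels_finite ρ v₀))
  obtain ⟨w, hw, hw'⟩ := computableWords_rabinRel_pointWord e hX
  refine ⟨fun n => ⟨k, w n :: L⟩, computable_encode_finPres hw L, fun n => ?_⟩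
  obtain ⟨φ⟩ := hL _ _ (hw' n)
  change PresentedGroup (rabinRels (pointRels ρ v₀) (pointWord ι (X n, 0))) ≃* _ at φ
  refine ⟨?_, ?_⟩
  · have h := map_commutator_eq _ φ.toMonoidHom
    rw [rabin_commutator, MonoidHom.range_eq_top.2 φ.surjective,
      Subgroup.map_top_of_surjective _ φ.surjective] at h
    exact h.symm
  rw [← hXS n, ← φ.toEquiv.subsingleton_congr]
  by_cases hn : ((X n : ℤ), (0 : ℤ)) ∈ S
  · have := rabin_subsingleton (pointRels ρ v₀) _ (pointWord_eq_one ρ v₀ hS' hn)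
    have := φ.toEquiv.symm.subsingleton
    exact ⟨fun g _ _ _ => Subsingleton.elim g 1, iff_of_true ‹_› hn⟩
  · obtain ⟨htf, hnt⟩ := rabin_torsionFree _ _ hH hne fun h => hn (hmem _ h)
    exact ⟨htf.of_injective φ.symm.toMonoidHom φ.symm.injective,
      iff_of_false (not_subsingleton _) hn⟩

/-- Theorem 2.6 (Chiodo): there is an explicit recursive procedure that, on input of
`m, n ∈ ℕ`, outputs a finite presentation `Π_{m,n}` of a torsion-free perfect group
which is trivial if and only if `n ∈ W_m`. -/
theorem uniform_perfect_torsionfree_presentation :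
    ∃ F : ℕ × ℕ → ℕ, Computable F ∧
      ∀ m n : ℕ, ∃ P : FinPres, F (m, n) = Encodable.encode P ∧
        commutator P.Grp = ⊤ ∧
        (∀ x : P.Grp, x ≠ 1 → orderOf x = 0) ∧
        (Subsingleton P.Grp ↔ n ∈ W m) := by
  have hf : Partrec fun p : ℕ =>
      (Denumerable.ofNat Nat.Partrec.Code p.unpair.1).eval p.unpair.2 :=
    Nat.Partrec.Code.eval_part.comp
      ((Computable.ofNat _).comp (Computable.fst.comp .unpair)) (Computable.snd.comp .unpair)
  obtain ⟨P, hP, hP'⟩ := FinPres.exists_of_partrec hf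
  refine ⟨fun p => Encodable.encode (P (Nat.pair p.1 p.2)),
    hP.comp (Primrec₂.natPair.to_comp.comp .fst .snd), fun m n => ⟨_, rfl, ?_⟩⟩
  obtain ⟨h1, h2, h3⟩ := hP' (Nat.pair m n)
  refine ⟨h1, fun x hx => h2.orderOf_eq_zero hx, h3.trans ?_⟩
  rw [Nat.unpair_pair]
  rfl
end

section
/- Let k : ℕ and let R be a finite set of relators in FreeGroup (Fin k), and suppose the presented group G = PresentedGroup R is a nontrivial simple group. Then the word problem for this presentation is decidable: the predicate on words w : List (Fin k × Bool) given by 'the image of FreeGroup.mk w in G equals 1' is a computable predicate (ComputablePred). -/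
/-- The projection of a primitive recursive relation along its second argument is
recursively enumerable. -/
theorem PrimrecRel.rePred_exists {α β : Type*} [Primcodable α] [Primcodable β]
    {p : α → β → Prop} (hp : PrimrecRel p) : REPred fun a => ∃ b, p a b := by
  classical
  have hguard : Computable₂ fun (a : α) (n : ℕ) =>
      (Encodable.decode (α := β) n).bind fun b => Option.guard (fun b => p a b) b := by
    refine Primrec₂.to_comp (Primrec.option_bind (Primrec.decode.comp Primrec.snd) ?_)
    exact Primrec.option_guard (hp.comp₂ (Primrec.fst.comp₂
      (Primrec.fst.comp₂ Primrec₂.left)) Primrec₂.right) Primrec.snd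
  refine (Partrec.rfindOpt hguard).dom_re.of_eq fun a => ?_
  rw [Nat.rfindOpt_dom]
  constructor
  · rintro ⟨n, b, h⟩
    obtain ⟨c, -, hc⟩ := Option.bind_eq_some_iff.1 h
    exact ⟨c, by simpa using (Option.guard_eq_some_iff.1 hc).2⟩
  · rintro ⟨b, hb⟩
    refine ⟨Encodable.encode b, b, ?_⟩
    simp [Option.guard, hb]

theorem REPred.comp {α β : Type*} [Primcodable α] [Primcodable β] {p : β → Prop}
    (hp : REPred p) {f : α → β} (hf : Computable f) : REPred fun a => p (f a) :=
  Partrec.comp hp hf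

namespace FreeGroup

section Primrec

variable {α : Type*} [Primcodable α]

theorem primrec_invRev : Primrec (invRev : List (α × Bool) → List (α × Bool)) :=
  Primrec.list_reverse.comp <| Primrec.list_map Primrec.id <|
    Primrec₂.pair.comp₂ (Primrec.fst.comp₂ Primrec₂.right)
      (Primrec.not.comp₂ (Primrec.snd.comp₂ Primrec₂.right))

theorem primrec_reduce [DecidableEq α] :
    Primrec (reduce : List (α × Bool) → List (α × Bool)) := by
  suffices h : Primrec₂ fun (_ : List (α × Bool))
      (q : (α × Bool) × List (α × Bool) × List (α × Bool)) =>
      (List.casesOn q.2.2 [q.1] fun hd tl =>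
        if q.1.1 = hd.1 ∧ q.1.2 = !hd.2 then tl else q.1 :: hd :: tl : List (α × Bool)) from
    (Primrec.list_rec Primrec.id (Primrec.const []) h).of_eq fun _ => rfl
  have hx : Primrec fun y : (List (α × Bool) × ((α × Bool) × List (α × Bool) ×
      List (α × Bool))) × ((α × Bool) × List (α × Bool)) => y.1.2.1 :=
    Primrec.fst.comp (Primrec.snd.comp Primrec.fst)
  have hhd : Primrec fun y : (List (α × Bool) × ((α × Bool) × List (α × Bool) ×
      List (α × Bool))) × ((α × Bool) × List (α × Bool)) => y.2.1 :=
    Primrec.fst.comp Primrec.snd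
  have htl : Primrec fun y : (List (α × Bool) × ((α × Bool) × List (α × Bool) ×
      List (α × Bool))) × ((α × Bool) × List (α × Bool)) => y.2.2 :=
    Primrec.snd.comp Primrec.snd
  have hih : Primrec fun y : List (α × Bool) × ((α × Bool) × List (α × Bool) ×
      List (α × Bool)) => y.2.2.2 :=
    Primrec.snd.comp (Primrec.snd.comp Primrec.snd)
  have hstep : Primrec₂ fun (y : List (α × Bool) × ((α × Bool) × List (α × Bool) ×
      List (α × Bool))) (z : (α × Bool) × List (α × Bool)) =>
      if y.2.1.1 = z.1.1 ∧ y.2.1.2 = !z.1.2 then z.2 else y.2.1 :: z.1 :: z.2 :=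
    Primrec.ite
      ((Primrec.eq.comp (Primrec.fst.comp hx) (Primrec.fst.comp hhd)).and
        (Primrec.eq.comp (Primrec.snd.comp hx) (Primrec.not.comp (Primrec.snd.comp hhd))))
      htl (Primrec.list_cons.comp hx (Primrec.list_cons.comp hhd htl))
  exact Primrec.list_casesOn hih
    (Primrec.list_cons.comp (Primrec.fst.comp Primrec.snd) (Primrec.const [])) hstep

end Primrec

variable {α : Type*}

/-- The product of conjugates of words of `S` encoded by `c`: the entry `(u, n)` stands for
the `n`-th word of `S`, or the empty word if there is none, conjugated by `u`. -/
def conjProd (S : List (List (α × Bool))) (c : List (List (α × Bool) × ℕ)) :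
    List (α × Bool) :=
  c.flatMap fun q => q.1 ++ S.getD q.2 [] ++ invRev q.1

theorem mk_append (u v : List (α × Bool)) : mk (u ++ v) = mk u * mk v :=
  mul_mk.symm

theorem mk_conjProd_mem {S : List (List (α × Bool))} {N : Subgroup (FreeGroup α)} [N.Normal]
    (hS : ∀ r ∈ S, mk r ∈ N) (c : List (List (α × Bool) × ℕ)) : mk (conjProd S c) ∈ N := by
  induction c with
  | nil => exact N.one_mem
  | cons q c ih =>
    have hq : mk (S.getD q.2 []) ∈ N := by
      by_cases h : q.2 < S.length
      · rw [List.getD_eq_getElem _ _ h]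
        exact hS _ (List.getElem_mem h)
      · rw [List.getD_eq_default _ _ (not_lt.1 h)]
        exact N.one_mem
    have : mk (conjProd S (q :: c)) =
        mk q.1 * mk (S.getD q.2 []) * (mk q.1)⁻¹ * mk (conjProd S c) := by
      simp only [conjProd, List.flatMap_cons, mk_append, inv_mk]
    rw [this]
    exact N.mul_mem (Subgroup.Normal.conj_mem inferInstance _ hq _) ih

theorem exists_mk_conjProd_eq {S : List (List (α × Bool))} {r : List (α × Bool)} (hr : r ∈ S)
    (g : FreeGroup α) (c : List (List (α × Bool) × ℕ)) :
    ∃ d, mk (conjProd S d) = g * mk r * g⁻¹ * mk (conjProd S c) := by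
  obtain ⟨n, hn, rfl⟩ := List.getElem_of_mem hr
  obtain ⟨u, rfl⟩ : ∃ u, mk u = g := Quot.exists_rep g
  refine ⟨(u, n) :: c, ?_⟩
  simp only [conjProd, List.flatMap_cons, mk_append, inv_mk, List.getD_eq_getElem _ _ hn]

theorem mem_normalClosure_iff_exists_conjProd (S : List (List (α × Bool))) (g : FreeGroup α) :
    g ∈ Subgroup.normalClosure (mk '' {r | r ∈ S}) ↔
      ∃ c, mk (conjProd (S ++ S.map invRev) c) = g := by
  constructor
  · intro hg
    induction hg using Subgroup.closure_induction_left with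
    | one => exact ⟨[], rfl⟩
    | mul_left x hx y _ ih =>
      obtain ⟨c, rfl⟩ := ih
      obtain ⟨_, ⟨r, hr, rfl⟩, hx⟩ := Group.mem_conjugatesOfSet_iff.1 hx
      obtain ⟨a, rfl⟩ := isConj_iff.1 hx
      exact exists_mk_conjProd_eq (List.mem_append_left _ hr) a c
    | inv_mul_cancel x hx y _ ih =>
      obtain ⟨c, rfl⟩ := ih
      obtain ⟨_, ⟨r, hr, rfl⟩, hx⟩ := Group.mem_conjugatesOfSet_iff.1 hx
      obtain ⟨a, rfl⟩ := isConj_iff.1 hx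
      rw [conj_inv, inv_mk]
      exact exists_mk_conjProd_eq (List.mem_append_right _ (List.mem_map_of_mem hr)) a c
  · rintro ⟨c, rfl⟩
    refine mk_conjProd_mem (fun r hr => ?_) c
    have key : ∀ r ∈ S, mk r ∈ Subgroup.normalClosure (mk '' {r | r ∈ S}) := fun r hr =>
      Subgroup.subset_normalClosure ⟨r, hr, rfl⟩
    rcases List.mem_append.1 hr with hr | hr
    · exact key r hr
    · obtain ⟨s, hs, rfl⟩ := List.mem_map.1 hr
      rw [← inv_mk]
      exact inv_mem (key s hs)

theorem primrec_conjProd [Primcodable α] : Primrec₂ (conjProd (α := α)) := by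
  refine Primrec.list_flatMap Primrec.snd ?_
  exact Primrec.list_append.comp
    (Primrec.list_append.comp (Primrec.fst.comp Primrec.snd)
      ((Primrec.list_getD []).comp (Primrec.fst.comp Primrec.fst)
        (Primrec.snd.comp Primrec.snd)))
    (primrec_invRev.comp (Primrec.fst.comp Primrec.snd))

/-- Membership in the normal closure of a finite list of words is recursively enumerable,
uniformly in the list. -/
theorem rePred_mem_normalClosure [Primcodable α] :
    REPred fun q : List (List (α × Bool)) × List (α × Bool) =>
      mk q.2 ∈ Subgroup.normalClosure (mk '' {r | r ∈ q.1}) := by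
  classical
  have h : PrimrecRel fun (q : List (List (α × Bool)) × List (α × Bool))
      (c : List (List (α × Bool) × ℕ)) =>
      reduce (conjProd (q.1 ++ q.1.map invRev) c) = reduce q.2 := by
    have hS : Primrec fun y : (List (List (α × Bool)) × List (α × Bool)) ×
        List (List (α × Bool) × ℕ) => y.1.1 := Primrec.fst.comp Primrec.fst
    exact Primrec.eq.comp
      (primrec_reduce.comp <| primrec_conjProd.comp
        (Primrec.list_append.comp hS
          (Primrec.list_map hS (primrec_invRev.comp₂ Primrec₂.right)))
        Primrec.snd)
      (primrec_reduce.comp (Primrec.snd.comp Primrec.fst))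
  refine h.rePred_exists.of_eq fun q => ?_
  rw [mem_normalClosure_iff_exists_conjProd]
  exact exists_congr fun c => ⟨reduce.exact, reduce.sound⟩

end FreeGroup

theorem PresentedGroup.mk_eq_one_iff_mem_normalClosure {α : Type*} {R : Set (FreeGroup α)}
    {g : FreeGroup α} : PresentedGroup.mk R g = 1 ↔ g ∈ Subgroup.normalClosure R :=
  QuotientGroup.eq_one_iff g

/-- In a simple presented group, an element is nontrivial if and only if adding it to the
relators kills a fixed nontrivial element. -/
theorem PresentedGroup.mk_ne_one_iff_mem_normalClosure_insert {α : Type*}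
    {R : Set (FreeGroup α)} [IsSimpleGroup (PresentedGroup R)] {g₀ : FreeGroup α}
    (hg₀ : PresentedGroup.mk R g₀ ≠ 1) (g : FreeGroup α) :
    PresentedGroup.mk R g ≠ 1 ↔ g₀ ∈ Subgroup.normalClosure (insert g R) := by
  constructor
  · intro hg
    set N := Subgroup.normalClosure (insert g R)
    have hRN : Subgroup.normalClosure R ≤ N :=
      Subgroup.normalClosure_mono (Set.subset_insert _ _)
    have hgN : g ∈ N := Subgroup.subset_normalClosure (Set.mem_insert _ _)
    have hmap : (N.map (PresentedGroup.mk R)).Normal :=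
      Subgroup.Normal.map inferInstance _ (PresentedGroup.mk_surjective R)
    rcases hmap.eq_bot_or_eq_top with h | h
    · exact absurd (Subgroup.mem_bot.1 (h ▸ Subgroup.mem_map_of_mem _ hgN)) hg
    · obtain ⟨x, hx, hxg⟩ : PresentedGroup.mk R g₀ ∈ N.map (PresentedGroup.mk R) :=
        h ▸ Subgroup.mem_top _
      have : x⁻¹ * g₀ ∈ N := hRN <| mk_eq_one_iff_mem_normalClosure.1 <| by
        rw [map_mul, map_inv, hxg, inv_mul_cancel]
      simpa using N.mul_mem hx this
  · intro h hg
    refine hg₀ (mk_eq_one_iff_mem_normalClosure.2 (Subgroup.normalClosure_le_normal ?_ h))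
    exact Set.insert_subset (mk_eq_one_iff_mem_normalClosure.1 hg)
      Subgroup.subset_normalClosure

/-- A finitely presented nontrivial simple group has decidable word problem: the
predicate on words `w` asserting that the image of `FreeGroup.mk w` in the presented
group is trivial is a computable predicate. -/
theorem word_problem_decidable_of_simple (k : ℕ) (R : Set (FreeGroup (Fin k)))
    (hR : R.Finite) [IsSimpleGroup (PresentedGroup R)] :
    ComputablePred fun w : List (Fin k × Bool) =>
      PresentedGroup.mk R (FreeGroup.mk w) = 1 := by
  obtain ⟨L, hL⟩ : ∃ L : List (List (Fin k × Bool)), FreeGroup.mk '' {r | r ∈ L} = R := by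
    refine ⟨hR.toFinset.toList.map FreeGroup.toWord, ?_⟩
    ext g
    simp [FreeGroup.mk_toWord]
  obtain ⟨g, hg⟩ := exists_ne (1 : PresentedGroup R)
  obtain ⟨g₀, rfl⟩ := PresentedGroup.mk_surjective R g
  obtain ⟨w₀, rfl⟩ : ∃ w, FreeGroup.mk w = g₀ := Quot.exists_rep g₀
  refine ComputablePred.computable_iff_re_compl_re'.2 ⟨?_, ?_⟩
  · refine (FreeGroup.rePred_mem_normalClosure.comp
      ((Computable.const L).pair Computable.id)).of_eq fun w => ?_
    rw [PresentedGroup.mk_eq_one_iff_mem_normalClosure, hL, id]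
  · refine (FreeGroup.rePred_mem_normalClosure.comp
      ((Computable.list_cons.comp Computable.id (Computable.const L)).pair
        (Computable.const w₀))).of_eq fun w => ?_
    have : FreeGroup.mk '' {r | r ∈ w :: L} = insert (FreeGroup.mk w) R := by
      rw [← hL, ← Set.image_insert_eq]
      congr 1
      ext r
      simp
    rw [← ne_eq, PresentedGroup.mk_ne_one_iff_mem_normalClosure_insert hg, ← this, id]
end

section
/- Let G be a nontrivial perfect group that is generated by two elements. Then G is indecomposable: G is not isomorphic to a free product A ∗ B (Monoid.Coprod) of two nontrivial groups A and B. -/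
section TwoGenerators

variable {G : Type*} [Group G]

theorem closure_pair_eq_top_of_mem {a b c d : G} (h : Subgroup.closure ({a, b} : Set G) = ⊤)
    (ha : a ∈ Subgroup.closure ({c, d} : Set G)) (hb : b ∈ Subgroup.closure ({c, d} : Set G)) :
    Subgroup.closure ({c, d} : Set G) = ⊤ := by
  rw [eq_top_iff, ← h, Subgroup.closure_le]
  rintro x (rfl | rfl)
  exacts [ha, hb]

theorem left_mem_closure_pair (c d : G) : c ∈ Subgroup.closure ({c, d} : Set G) :=
  Subgroup.subset_closure (by simp)

theorem right_mem_closure_pair (c d : G) : d ∈ Subgroup.closure ({c, d} : Set G) :=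
  Subgroup.subset_closure (by simp)

theorem map_closure_pair_eq_top {H : Type*} [Group H] {f : G →* H} (hf : Function.Surjective f)
    {a b : G} (h : Subgroup.closure ({a, b} : Set G) = ⊤) :
    Subgroup.closure ({f a, f b} : Set H) = ⊤ := by
  rw [← Set.image_pair, ← MonoidHom.map_closure, h, Subgroup.map_top_of_surjective f hf]

theorem closure_conj_pair_eq_top (u : G) {a b : G}
    (h : Subgroup.closure ({a, b} : Set G) = ⊤) :
    Subgroup.closure ({u * a * u⁻¹, u * b * u⁻¹} : Set G) = ⊤ :=
  map_closure_pair_eq_top (f := (MulAut.conj u).toMonoidHom) (MulAut.conj u).surjective h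

/-- An integral length function in the sense of Lyndon: `L (x⁻¹ * y)` is the distance between
translates of the midpoint of an edge in a simplicial tree on which `G` acts transitively
on the edges. -/
structure IsTreeLength (L : G → ℕ) : Prop where
  one : L 1 = 0
  inv : ∀ g, L g⁻¹ = L g
  ultra : ∀ x y z, L y + L (x⁻¹ * z) ≤ max (L x + L (y⁻¹ * z)) (L z + L (x⁻¹ * y))
  split : ∀ g, ∀ n ≤ L g, ∃ h k, h * k = g ∧ L h = n ∧ L h + L k = L g

namespace IsTreeLength

variable {L : G → ℕ}

theorem fourPoint (hL : IsTreeLength L) (p q r : G) :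
    L (p * q) + L (q * r) ≤ max (L p + L r) (L (p * q * r) + L q) := by
  simpa [mul_assoc] using hL.ultra p (p * q) (p * q * r)

theorem mul_le (hL : IsTreeLength L) (p q : G) : L (p * q) ≤ L p + L q := by
  have := hL.fourPoint p q q⁻¹
  simp [hL.one, hL.inv] at this
  exact this

theorem mul_swap_le_of_mul_self_le (hL : IsTreeLength L) {a h k : G} (hhk : h * k = a)
    (hle : 2 * L h ≤ L a) (hadd : L h + L k = L a) (haa : L (a * a) ≤ L a) :
    L (k * h) ≤ L a - 2 * L h := by
  have h₁ := hL.ultra k⁻¹ a⁻¹ a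
  have h₂ := hL.ultra k⁻¹ a h
  have e₁ : k * a⁻¹ = h⁻¹ := by subst hhk; group
  have e₂ : a⁻¹ * h = k⁻¹ := by subst hhk; group
  simp only [inv_inv, e₁, e₂, hL.inv] at h₁ h₂
  omega

/-- A pair of generators of minimal total length. -/
def MinimalPair (L : G → ℕ) (a b : G) : Prop :=
  Subgroup.closure ({a, b} : Set G) = ⊤ ∧
    ∀ c d, Subgroup.closure ({c, d} : Set G) = ⊤ → L a + L b ≤ L c + L d

theorem exists_minimalPair (L : G → ℕ) (h : ∃ a b : G, Subgroup.closure ({a, b} : Set G) = ⊤) :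
    ∃ a b, MinimalPair L a b := by
  obtain ⟨a, b, hab⟩ := h
  obtain ⟨p, hp, hmin⟩ := WellFounded.has_min
    (measure fun p : G × G => L p.1 + L p.2).wf
    {p : G × G | Subgroup.closure ({p.1, p.2} : Set G) = ⊤} ⟨(a, b), hab⟩
  exact ⟨p.1, p.2, hp, fun c d hcd => not_lt.1 (hmin (c, d) hcd)⟩

namespace MinimalPair

variable {a b : G}

theorem symm (h : MinimalPair L a b) : MinimalPair L b a := by
  refine ⟨by rw [Set.pair_comm]; exact h.1, fun c d hcd => ?_⟩
  have := h.2 c d hcd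
  omega

theorem inv_left (h : MinimalPair L a b) (hL : IsTreeLength L) : MinimalPair L a⁻¹ b := by
  refine ⟨closure_pair_eq_top_of_mem h.1 ?_ (right_mem_closure_pair _ _), ?_⟩
  · simpa using inv_mem (left_mem_closure_pair a⁻¹ b)
  · simpa only [hL.inv] using h.2

theorem inv_right (h : MinimalPair L a b) (hL : IsTreeLength L) : MinimalPair L a b⁻¹ :=
  (h.symm.inv_left hL).symm

theorem right_le_mul (h : MinimalPair L a b) : L b ≤ L (a * b) := by
  have := h.2 a (a * b) <| closure_pair_eq_top_of_mem h.1 (left_mem_closure_pair _ _) <| by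
    simpa using mul_mem (inv_mem (left_mem_closure_pair a (a * b)))
      (right_mem_closure_pair a (a * b))
  omega

theorem left_le_mul (h : MinimalPair L a b) : L a ≤ L (a * b) := by
  have := h.2 (a * b) b <| closure_pair_eq_top_of_mem h.1 (by
    simpa using mul_mem (left_mem_closure_pair (a * b) b)
      (inv_mem (right_mem_closure_pair (a * b) b))) (right_mem_closure_pair _ _)
  omega

variable (hL : IsTreeLength L)
  (htwo : ∀ a b : G, Subgroup.closure ({a, b} : Set G) = ⊤ → 2 ≤ L a)
include hL htwo

theorem lt_mul_self (h : MinimalPair L a b) : L a < L (a * a) := by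
  by_contra! hle
  obtain ⟨x, k, hxk, hx, hadd⟩ := hL.split a (L a / 2) (by omega)
  have h₁ := hL.mul_swap_le_of_mul_self_le hxk (by omega) hadd hle
  have h₂ := htwo _ _ (closure_conj_pair_eq_top x⁻¹ h.1)
  have e : x⁻¹ * a * x⁻¹⁻¹ = k * x := by subst hxk; group
  rw [e] at h₂
  omega

theorem not_both_le (h : MinimalPair L a b) (h₁ : L (a⁻¹ * b) ≤ L b) (h₂ : L (b * a⁻¹) ≤ L b) :
    False := by
  have ha := htwo a b h.1
  have hab : L a ≤ L b := by
    have := (h.inv_left hL).left_le_mul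
    rw [hL.inv] at this
    omega
  obtain ⟨x, k, hxk, hx, hadd⟩ := hL.split a (L a / 2) (by omega)
  have hswap := hL.mul_le k x
  have u₁ := hL.ultra b⁻¹ a⁻¹ k⁻¹
  have u₂ := hL.ultra x a b
  have u₃ := hL.ultra x b (b * k⁻¹)
  have e₁ : a * k⁻¹ = x := by subst hxk; group
  have e₂ : x⁻¹ * a = k := by subst hxk; group
  have e₃ : b⁻¹ * (b * k⁻¹) = k⁻¹ := by group
  simp only [inv_inv, e₁, e₂, e₃, hL.inv] at u₁ u₂ u₃
  have hgen : Subgroup.closure ({k * x, x⁻¹ * (b * k⁻¹)} : Set G) = ⊤ := by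
    have hc := closure_conj_pair_eq_top x⁻¹ h.1
    have e₄ : x⁻¹ * a * x⁻¹⁻¹ = k * x := by subst hxk; group
    have e₅ : x⁻¹ * b * x⁻¹⁻¹ = x⁻¹ * (b * k⁻¹) * (k * x) := by group
    rw [e₄, e₅] at hc
    exact closure_pair_eq_top_of_mem hc (left_mem_closure_pair _ _)
      (mul_mem (right_mem_closure_pair _ _) (left_mem_closure_pair _ _))
  have := h.2 _ _ hgen
  omega

theorem two_mul_lt (h : MinimalPair L a b) : 2 * L b < L (b * a) + L (a * b) := by
  have h₁ := h.right_le_mul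
  have h₂ := h.symm.left_le_mul
  have h₃ := (h.inv_left hL).not_both_le hL htwo
  rw [inv_inv] at h₃
  by_contra!
  exact h₃ (by omega) (by omega)

theorem two_mul_lt_inv (h : MinimalPair L a b) : 2 * L b < L (b * a) + L (a * b⁻¹) := by
  have h₁ := (h.inv_right hL).right_le_mul
  have h₂ := h.symm.left_le_mul
  have h₃ := h.lt_mul_self hL htwo
  have u := hL.ultra a⁻¹ b⁻¹ a
  simp only [inv_inv, hL.inv] at u h₁
  by_contra!
  omega

end MinimalPair

/-- The value of a letter of a word in the free group on two generators. -/
def letterValue (f : Bool → G) (s : Bool × Bool) : G := cond s.2 (f s.1) (f s.1)⁻¹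

theorem letterValue_add_lt (hL : IsTreeLength L)
    (htwo : ∀ a b : G, Subgroup.closure ({a, b} : Set G) = ⊤ → 2 ≤ L a)
    {f : Bool → G} (hf : MinimalPair L (f true) (f false)) {r s t : Bool × Bool}
    (hrs : r.1 = s.1 → r.2 = s.2) (hst : s.1 = t.1 → s.2 = t.2) :
    L (letterValue f r) + L (letterValue f t) <
      L (letterValue f r * letterValue f s) + L (letterValue f s * letterValue f t) := by
  have hmin : ∀ s t : Bool × Bool, s.1 ≠ t.1 →
      MinimalPair L (letterValue f s) (letterValue f t) := by
    have hf' := hf.symm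
    rintro ⟨_ | _, _ | _⟩ ⟨_ | _, _ | _⟩ hne <;> simp only [letterValue, cond_true, cond_false] <;>
      first
      | exact absurd rfl hne
      | assumption
      | exact hf.inv_left hL
      | exact hf.inv_right hL
      | exact (hf.inv_right hL).inv_left hL
      | exact hf'.inv_left hL
      | exact hf'.inv_right hL
      | exact (hf'.inv_right hL).inv_left hL
  have hsq : ∀ s, L (letterValue f s) < L (letterValue f s * letterValue f s) := fun s =>
    (hmin s (!s.1, s.2) (by simp)).lt_mul_self hL htwo
  by_cases h₁ : r.1 = s.1 <;> by_cases h₂ : s.1 = t.1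
  · obtain rfl : r = s := Prod.ext h₁ (hrs h₁)
    obtain rfl : r = t := Prod.ext h₂ (hst h₂)
    have := hsq r
    omega
  · obtain rfl : r = s := Prod.ext h₁ (hrs h₁)
    have := hsq r
    have := (hmin r t h₂).right_le_mul
    omega
  · obtain rfl : s = t := Prod.ext h₂ (hst h₂)
    have := hsq s
    have := (hmin r s h₁).left_le_mul
    omega
  · have h₃ : r.1 = t.1 := by
      revert h₁ h₂
      generalize r.1 = x, s.1 = y, t.1 = z
      decide +revert
    have hm := hmin s r (Ne.symm h₁)
    by_cases h₄ : r.2 = t.2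
    · obtain rfl : r = t := Prod.ext h₃ h₄
      have := hm.two_mul_lt hL htwo
      omega
    · have e : letterValue f t = (letterValue f r)⁻¹ := by
        obtain ⟨r₁, r₂⟩ := r
        obtain ⟨t₁, t₂⟩ := t
        obtain rfl : r₁ = t₁ := h₃
        cases r₂ <;> cases t₂ <;> simp_all [letterValue]
      have := hm.two_mul_lt_inv hL htwo
      rw [e, hL.inv]
      omega

theorem letterValue_prod_lt (hL : IsTreeLength L)
    (htwo : ∀ a b : G, Subgroup.closure ({a, b} : Set G) = ⊤ → 2 ≤ L a)
    {f : Bool → G} (hf : MinimalPair L (f true) (f false)) (l : List (Bool × Bool)) :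
    ∀ s, FreeGroup.IsReduced (s :: l) → ∀ r : Bool × Bool, (r.1 = s.1 → r.2 = s.2) →
      L (l.map (letterValue f)).prod + L (letterValue f r) <
        L (letterValue f r * letterValue f s) + L ((s :: l).map (letterValue f)).prod := by
  induction l with
  | nil =>
    intro s _ r hrs
    have h₁ := hL.letterValue_add_lt htwo hf hrs (fun _ => rfl : s.1 = s.1 → s.2 = s.2)
    have h₂ := hL.mul_le (letterValue f s) (letterValue f s)
    simp [hL.one]
    omega
  | cons t l ih =>
    intro s hst r hrs
    rw [FreeGroup.isReduced_cons_cons] at hst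
    have h₁ := ih t hst.2 s hst.1
    have h₂ := hL.letterValue_add_lt htwo hf hrs hst.1
    have h₃ := hL.fourPoint (letterValue f s) (letterValue f t) (l.map (letterValue f)).prod
    simp only [List.map_cons, List.prod_cons, mul_assoc] at h₁ h₃ ⊢
    omega

theorem injective_lift (hL : IsTreeLength L)
    (htwo : ∀ a b : G, Subgroup.closure ({a, b} : Set G) = ⊤ → 2 ≤ L a)
    {f : Bool → G} (hf : MinimalPair L (f true) (f false)) :
    Function.Injective (FreeGroup.lift f) := by
  rw [injective_iff_map_eq_one]
  intro w hw
  rw [← FreeGroup.toWord_eq_nil_iff]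
  have hred : FreeGroup.IsReduced w.toWord := FreeGroup.isReduced_toWord
  rw [← FreeGroup.mk_toWord (x := w), FreeGroup.lift_mk] at hw
  change (w.toWord.map (letterValue f)).prod = 1 at hw
  generalize w.toWord = l at hred hw
  cases l with
  | nil => rfl
  | cons s l =>
    have h₁ := hL.letterValue_prod_lt htwo hf l s hred s (fun _ => rfl)
    have e : (l.map (letterValue f)).prod = (letterValue f s)⁻¹ := by
      rw [List.map_cons, List.prod_cons] at hw
      exact (inv_eq_of_mul_eq_one_right hw).symm
    rw [hw, e, hL.one, hL.inv] at h₁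
    have := hL.mul_le (letterValue f s) (letterValue f s)
    omega

theorem commutator_ne_top (hL : IsTreeLength L)
    (hgen : ∃ a b : G, Subgroup.closure ({a, b} : Set G) = ⊤)
    (htwo : ∀ a b : G, Subgroup.closure ({a, b} : Set G) = ⊤ → 2 ≤ L a) :
    commutator G ≠ ⊤ := by
  intro hperf
  obtain ⟨a, b, hab⟩ := exists_minimalPair L hgen
  let f : Bool → G := fun i => cond i a b
  have hinj : Function.Injective (FreeGroup.lift f) := hL.injective_lift htwo hab
  have hsurj : Function.Surjective (FreeGroup.lift f) := by
    rw [← MonoidHom.range_eq_top, FreeGroup.range_lift_eq_closure, eq_top_iff, ← hab.1]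
    refine Subgroup.closure_mono ?_
    rintro x (rfl | rfl)
    exacts [⟨true, rfl⟩, ⟨false, rfl⟩]
  let e := MulEquiv.ofBijective (FreeGroup.lift f) ⟨hinj, hsurj⟩
  let φ : G →* Multiplicative ℤ :=
    (FreeGroup.lift fun _ : Bool => Multiplicative.ofAdd (1 : ℤ)).comp e.symm.toMonoidHom
  have hφ : φ (e (FreeGroup.of true)) = 1 :=
    Abelianization.commutator_subset_ker φ (hperf ▸ Subgroup.mem_top _)
  simp [φ] at hφ

end IsTreeLength

end TwoGenerators

namespace Monoid.CoprodI

variable {ι : Type*} {M : ι → Type*} [∀ i, Group (M i)]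

open Classical in
/-- The list of syllables of the normal form of an element of a free product. -/
noncomputable def syllables (g : CoprodI M) : List (Σ i, M i) := (Word.equiv g).toList

/-- The number of syllables of the normal form of an element of a free product. -/
noncomputable def syllableLength (g : CoprodI M) : ℕ := (syllables g).length

/-- The product of a list of syllables. -/
def syllableProd (l : List (Σ i, M i)) : CoprodI M := (l.map fun s => of s.2).prod

/-- A list of syllables is reduced if it is the syllable list of a reduced word. -/
def IsReducedList (l : List (Σ i, M i)) : Prop :=
  (∀ s ∈ l, s.2 ≠ 1) ∧ l.IsChain fun s t => s.1 ≠ t.1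

theorem isReducedList_syllables (g : CoprodI M) : IsReducedList (syllables g) := by
  classical
  exact ⟨fun s hs => (Word.equiv g).ne_one s hs, (Word.equiv g).chain_ne⟩

theorem syllableProd_syllables (g : CoprodI M) : syllableProd (syllables g) = g := by
  classical
  exact Word.equiv.symm_apply_apply g

theorem IsReducedList.syllables_prod {l : List (Σ i, M i)} (hl : IsReducedList l) :
    syllables (syllableProd l) = l := by
  classical
  exact congrArg Word.toList (Word.equiv.apply_symm_apply (⟨l, hl.1, hl.2⟩ : Word M))

theorem IsReducedList.length_prod {l : List (Σ i, M i)} (hl : IsReducedList l) :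
    syllableLength (syllableProd l) = l.length := by
  rw [syllableLength, hl.syllables_prod]

/-- The formal inverse of a list of syllables. -/
def invList (l : List (Σ i, M i)) : List (Σ i, M i) := (l.map fun s => ⟨s.1, s.2⁻¹⟩).reverse

@[simp]
theorem length_invList (l : List (Σ i, M i)) : (invList l).length = l.length := by
  simp [invList]

@[simp]
theorem invList_cons (s : Σ i, M i) (l : List (Σ i, M i)) :
    invList (s :: l) = invList l ++ [⟨s.1, s.2⁻¹⟩] := by
  simp [invList]

@[simp]
theorem syllableProd_cons (s : Σ i, M i) (l : List (Σ i, M i)) :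
    syllableProd (s :: l) = of s.2 * syllableProd l := by
  simp [syllableProd]

@[simp]
theorem syllableProd_append (l l' : List (Σ i, M i)) :
    syllableProd (l ++ l') = syllableProd l * syllableProd l' := by
  simp [syllableProd]

@[simp]
theorem syllableProd_invList (l : List (Σ i, M i)) :
    syllableProd (invList l) = (syllableProd l)⁻¹ := by
  induction l with
  | nil => simp [invList, syllableProd]
  | cons s l ih => simp [ih]; simp [syllableProd]

theorem IsReducedList.invList {l : List (Σ i, M i)} (hl : IsReducedList l) :
    IsReducedList (invList l) := by
  refine ⟨fun s hs => ?_, ?_⟩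
  · simp only [CoprodI.invList, List.mem_reverse, List.mem_map] at hs
    obtain ⟨t, ht, rfl⟩ := hs
    simpa using hl.1 t ht
  · rw [CoprodI.invList, List.isChain_reverse, List.isChain_map]
    exact hl.2.imp fun _ _ h => h.symm

theorem IsReducedList.append_left {l l' : List (Σ i, M i)} (h : IsReducedList (l ++ l')) :
    IsReducedList l :=
  ⟨fun s hs => h.1 s (List.mem_append_left _ hs), h.2.left_of_append⟩

theorem IsReducedList.append_right {l l' : List (Σ i, M i)} (h : IsReducedList (l ++ l')) :
    IsReducedList l' :=
  ⟨fun s hs => h.1 s (List.mem_append_right _ hs), h.2.right_of_append⟩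

theorem IsReducedList.tail {s : Σ i, M i} {l : List (Σ i, M i)} (h : IsReducedList (s :: l)) :
    IsReducedList l :=
  h.append_right (l := [s])

/-- Two reduced lists starting in different factors concatenate, after formal inversion of the
first one, to a reduced list. -/
theorem IsReducedList.invList_append {l l' : List (Σ i, M i)} (hl : IsReducedList l)
    (hl' : IsReducedList l') (h : ∀ s ∈ l.head?, ∀ t ∈ l'.head?, s.1 ≠ t.1) :
    IsReducedList (CoprodI.invList l ++ l') := by
  refine ⟨fun s hs => ?_, ?_⟩
  · exact (List.mem_append.1 hs).elim (hl.invList.1 s) (hl'.1 s)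
  · refine List.isChain_append.2 ⟨hl.invList.2, hl'.2, ?_⟩
    intro x hx y hy
    simp only [CoprodI.invList, List.getLast?_reverse, List.head?_map, Option.mem_def,
      Option.map_eq_some_iff] at hx
    obtain ⟨s, hs, rfl⟩ := hx
    exact h s hs y hy

open Classical in
/-- Twice the length of the common initial segment of two words, where starting in the same
factor with different syllables counts as a half. -/
noncomputable def agreement : List (Σ i, M i) → List (Σ i, M i) → ℕ
  | s :: l, t :: l' => if s = t then agreement l l' + 2 else if s.1 = t.1 then 1 else 0
  | _, _ => 0

theorem min_agreement_le {N : ι → Type*} (l₁ l₂ l₃ : List (Σ i, N i)) :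
    min (agreement l₁ l₂) (agreement l₂ l₃) ≤ agreement l₁ l₃ := by
  induction l₁ generalizing l₂ l₃ with
  | nil => simp [agreement]
  | cons s l₁ ih =>
    cases l₂ with
    | nil => simp [agreement]
    | cons t l₂ =>
      cases l₃ with
      | nil => simp [agreement]
      | cons r l₃ =>
        have := ih l₂ l₃
        simp only [agreement]
        grind

theorem length_inv_mul_add_agreement {l₁ l₂ : List (Σ i, M i)} (h₁ : IsReducedList l₁)
    (h₂ : IsReducedList l₂) :
    syllableLength ((syllableProd l₁)⁻¹ * syllableProd l₂) + agreement l₁ l₂ =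
      l₁.length + l₂.length := by
  induction l₁ generalizing l₂ with
  | nil =>
    have := h₂.length_prod
    simp_all [agreement, syllableProd]
  | cons s l₁ ih =>
    cases l₂ with
    | nil =>
      have := h₁.invList.length_prod
      rw [syllableProd_invList, length_invList] at this
      simp only [agreement, List.length_nil, add_zero]
      rw [← this]
      simp [syllableProd]
    | cons t l₂ =>
      simp only [agreement]
      split_ifs with hst hfst
      · subst hst
        have := ih h₁.tail h₂.tail
        simp only [syllableProd_cons, List.length_cons, mul_inv_rev, mul_assoc,
          inv_mul_cancel_left] at this ⊢
        omega
      · obtain ⟨i, x⟩ := s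
        obtain ⟨j, y⟩ := t
        obtain rfl : i = j := hfst
        have hxy : x⁻¹ * y ≠ 1 := fun h => hst (by rw [inv_mul_eq_one.1 h])
        have hred : IsReducedList (⟨i, x⁻¹ * y⟩ :: l₂ : List (Σ i, M i)) := by
          refine ⟨?_, ?_⟩
          · intro r hr
            rcases List.mem_cons.1 hr with rfl | hr
            exacts [hxy, h₂.tail.1 r hr]
          · have := h₂.2
            rw [List.isChain_cons] at this ⊢
            exact this
        have := (h₁.tail.invList_append hred (by
          intro r hr t ht
          have := (List.isChain_cons.1 h₁.2).1 r hr
          simp at ht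
          subst ht
          exact this.symm)).length_prod
        simp only [syllableProd_append, syllableProd_invList, syllableProd_cons, map_mul, map_inv,
          List.length_append, length_invList, List.length_cons] at this
        simp only [syllableProd_cons, List.length_cons, mul_inv_rev, mul_assoc] at this ⊢
        omega
      · have := (h₁.invList_append h₂ (by simpa using hfst)).length_prod
        simp only [syllableProd_append, syllableProd_invList, List.length_append,
          length_invList] at this
        omega

theorem length_inv_mul_add_agreement_syllables (x y : CoprodI M) :
    syllableLength (x⁻¹ * y) + agreement (syllables x) (syllables y) =
      syllableLength x + syllableLength y := by
  simpa only [syllableProd_syllables, syllableLength] using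
    length_inv_mul_add_agreement (isReducedList_syllables x) (isReducedList_syllables y)

theorem isTreeLength_syllableLength : IsTreeLength (syllableLength : CoprodI M → ℕ) where
  one := IsReducedList.length_prod (M := M) (l := []) ⟨by simp, by simp⟩
  inv g := by
    have := (isReducedList_syllables g).invList.length_prod
    rwa [syllableProd_invList, syllableProd_syllables, length_invList] at this
  ultra x y z := by
    have h₁ := length_inv_mul_add_agreement_syllables x y
    have h₂ := length_inv_mul_add_agreement_syllables y z
    have h₃ := length_inv_mul_add_agreement_syllables x z
    have h₄ := min_agreement_le (syllables x) (syllables y) (syllables z)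
    omega
  split g n hn := by
    have hred := isReducedList_syllables g
    rw [← List.take_append_drop n (syllables g)] at hred
    refine ⟨syllableProd ((syllables g).take n), syllableProd ((syllables g).drop n), ?_, ?_, ?_⟩
    · rw [← syllableProd_append, List.take_append_drop, syllableProd_syllables]
    · rw [hred.append_left.length_prod, List.length_take]
      exact min_eq_left hn
    · rw [hred.append_left.length_prod, hred.append_right.length_prod, ← List.length_append,
        List.take_append_drop]
      rfl

theorem exists_of_eq_of_syllableLength_le_one [Nonempty ι] {g : CoprodI M}
    (h : syllableLength g ≤ 1) : ∃ (i : ι) (m : M i), of m = g := by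
  rw [← syllableProd_syllables g]
  unfold syllableLength at h
  generalize syllables g = l at h
  match l with
  | [] => exact ⟨Classical.arbitrary ι, 1, by simp [syllableProd]⟩
  | [s] => exact ⟨s.1, s.2, by simp [syllableProd]⟩
  | _ :: _ :: _ => simp at h

theorem subsingleton_of_closure_pair [DecidableEq ι] {i j : ι} (hij : i ≠ j) (m : M i)
    (b : CoprodI M) (hperf : commutator (CoprodI M) = ⊤)
    (hgen : Subgroup.closure ({of m, b} : Set (CoprodI M)) = ⊤) : Subsingleton (M j) := by
  let p : CoprodI M →* M j := lift (Pi.mulSingle j (MonoidHom.id (M j)))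
  have hp : Function.Surjective p := of_leftInverse j |>.surjective
  have hm : p (of m) = 1 := by simp [p, hij]
  have hcyc := map_closure_pair_eq_top hp hgen
  rw [hm, Subgroup.closure_insert_one] at hcyc
  have hcomm : ∀ x y : M j, x * y = y * x := by
    intro x y
    obtain ⟨n, rfl⟩ := Subgroup.mem_closure_singleton.1 (hcyc ▸ Subgroup.mem_top x)
    obtain ⟨k, rfl⟩ := Subgroup.mem_closure_singleton.1 (hcyc ▸ Subgroup.mem_top y)
    exact (Commute.refl (p b)).zpow_zpow n k
  let _ : CommGroup (M j) := { (inferInstance : Group (M j)) with mul_comm := hcomm }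
  have htriv : ∀ x : M j, x = 1 := by
    intro x
    obtain ⟨g, rfl⟩ := hp x
    exact Abelianization.commutator_subset_ker p (hperf ▸ Subgroup.mem_top g)
  exact ⟨fun x y => (htriv x).trans (htriv y).symm⟩

theorem commutator_ne_top_of_closure_pair [Nontrivial ι] [∀ i, Nontrivial (M i)]
    (hgen : ∃ a b : CoprodI M, Subgroup.closure ({a, b} : Set (CoprodI M)) = ⊤) :
    commutator (CoprodI M) ≠ ⊤ := by
  classical
  intro hperf
  refine isTreeLength_syllableLength.commutator_ne_top hgen (fun a b hab => ?_) hperf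
  by_contra! hlt
  obtain ⟨i, m, rfl⟩ := exists_of_eq_of_syllableLength_le_one (Nat.le_of_lt_succ hlt)
  obtain ⟨j, hj⟩ := exists_ne i
  have := subsingleton_of_closure_pair hj.symm m b hperf hab
  exact not_subsingleton (M j) this

end Monoid.CoprodI

namespace Monoid.Coprod

variable (A B : Type*) [Group A] [Group B]

/-- The images of the two factors in the free product. -/
def factor (i : Bool) : Subgroup (Coprod A B) :=
  cond i (inl : A →* Coprod A B).range (inr : B →* Coprod A B).range

instance [Nontrivial A] [Nontrivial B] (i : Bool) : Nontrivial (factor A B i) := by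
  cases i
  · exact (MonoidHom.ofInjective (inr_injective (M := A) (N := B))).injective.nontrivial
  · exact (MonoidHom.ofInjective (inl_injective (M := A) (N := B))).injective.nontrivial

/-- The binary free product is the indexed free product of the images of its factors. -/
def equivCoprodI : Coprod A B ≃* CoprodI fun i => factor A B i :=
  MonoidHom.toMulEquiv
    (lift ((CoprodI.of (M := fun i => factor A B i) (i := true)).comp
        (inl : A →* Coprod A B).rangeRestrict)
      ((CoprodI.of (M := fun i => factor A B i) (i := false)).comp
        (inr : B →* Coprod A B).rangeRestrict))
    (CoprodI.lift fun i => (factor A B i).subtype)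
    (by ext <;> simp <;> rfl)
    (by
      ext i ⟨x, hx⟩
      cases i <;> obtain ⟨x, rfl⟩ := hx <;> simp <;> rfl)

end Monoid.Coprod

/-- Cf. Lemma 5.4 (Chiodo): a nontrivial perfect group generated by two elements is
indecomposable: it is not isomorphic to the free product of two nontrivial groups. -/
theorem perfect_two_generated_indecomposable (G : Type*) [Group G] [Nontrivial G]
    (hperf : commutator G = ⊤)
    (hgen : ∃ a b : G, Subgroup.closure ({a, b} : Set G) = ⊤)
    (A : Type*) (B : Type*) [Group A] [Group B] [Nontrivial A] [Nontrivial B] :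
    IsEmpty (G ≃* Monoid.Coprod A B) := by
  refine ⟨fun e => ?_⟩
  let e' := e.trans (Monoid.Coprod.equivCoprodI A B)
  obtain ⟨a, b, hab⟩ := hgen
  refine Monoid.CoprodI.commutator_ne_top_of_closure_pair
    ⟨e' a, e' b, map_closure_pair_eq_top (f := e'.toMonoidHom) e'.surjective hab⟩ ?_
  rw [commutator_def, ← Subgroup.map_top_of_surjective e'.toMonoidHom e'.surjective,
    ← Subgroup.map_commutator, ← commutator_def, hperf]
end
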